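/- Let n > 8, let S̃_n be Schur's double cover of S_n with projection π, and let (ρ, V) be an irreducible spin representation of S̃_n with dim_ℂ V = 2^{⌊(n−1)/2⌋} (a basic spin representation). Let g ∈ S̃_n with k = k(g) the order of π(g), and assume that 3 IS a solitary part of the cycle type of π(g) while 5 is NOT a solitary part of the cycle type of π(g). Then 3 divides k and the minimal polynomial p(X) of ρ(g) satisfies p(X) · (X^{k/3} − ε_g) = X^k − ε_g. -/

import Mathlib

/-!
Schur's double cover `S̃_N` of the symmetric group, presented by generators
`z, t_1, …, t_{N-1}` and relations `z² = 1`, `t_i² = z`, `(t_i t_{i+1})³ = z`,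
`(t_i t_j)² = z` for `|i − j| ≥ 2`.

Generators are indexed by `Option (Fin (N-1))`: `none` is the central element `z`
and `some i` is `t_{i+1}` (so `some i` for `i = 0, …, N-2` are `t_1, …, t_{N-1}`).
-/

abbrev SchurGen (N : ℕ) := Option (Fin (N - 1))

namespace Schur

/-- The relator `z` as an element of the free group. -/
def zf (N : ℕ) : FreeGroup (SchurGen N) := FreeGroup.of none

/-- The generator `t_{i+1}` as an element of the free group. -/
def tf (N : ℕ) (i : Fin (N - 1)) : FreeGroup (SchurGen N) := FreeGroup.of (some i)

/-- The defining relators of Schur's double cover. -/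
def rels (N : ℕ) : Set (FreeGroup (SchurGen N)) :=
  { r | r = zf N ^ 2 ∨
        (∃ i, r = tf N i ^ 2 * (zf N)⁻¹) ∨
        (∃ i j : Fin (N - 1), (i : ℕ) + 1 = (j : ℕ) ∧
          r = (tf N i * tf N j) ^ 3 * (zf N)⁻¹) ∨
        (∃ i j : Fin (N - 1), ((i : ℕ) + 2 ≤ (j : ℕ) ∨ (j : ℕ) + 2 ≤ (i : ℕ)) ∧
          r = (tf N i * tf N j) ^ 2 * (zf N)⁻¹) }

/-- Schur's double cover `S̃_N` of the symmetric group `S_N`. -/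
abbrev Cover (N : ℕ) := PresentedGroup (rels N)

/-- The central element `z` of `S̃_N`. -/
def z (N : ℕ) : Cover N := PresentedGroup.of none

/-- The generator `t_{i+1}` of `S̃_N` (0-indexed). -/
def t (N : ℕ) (i : Fin (N - 1)) : Cover N := PresentedGroup.of (some i)

/-- The generator `t_i` of `S̃_N`, 1-indexed: meaningful for `1 ≤ i ≤ N-1`
(junk value `1` outside this range). -/
def T (N i : ℕ) : Cover N := if h : i - 1 < N - 1 then t N ⟨i - 1, h⟩ else 1

/-- The product `t_a t_{a+1} ⋯ t_{a+n-1}` (`n` consecutive generators, 1-indexed). -/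
def P (N a n : ℕ) : Cover N := ((List.range n).map fun j => T N (a + j)).prod

end Schur


/-- The adjacent transposition `(i, i+1)` of `{1, …, n}`: in 0-indexed terms, for
`i : Fin (n-1)` this is the swap of `i` and `i+1` in `Fin n`.  It is the image of the
generator `t_{i+1}` under the canonical projection `S̃_n → S_n`. -/
def Schur.adj (n : ℕ) (i : Fin (n - 1)) : Equiv.Perm (Fin n) :=
  Equiv.swap ⟨i.1, by have := i.2; omega⟩ ⟨i.1 + 1, by have := i.2; omega⟩

/-- `d` is a *solitary part* of the cycle type of a permutation `σ` if exactly one cycle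
of `σ` has length divisible by `d` and this cycle has length `d` (fixed points count as
cycles of length 1; for `d = 3, 5` these never have length divisible by `d`, so Mathlib's
`cycleType`, which omits fixed points, captures the condition). -/
def Schur.SolitaryPart (d : ℕ) {α : Type*} [Fintype α] [DecidableEq α]
    (σ : Equiv.Perm α) : Prop :=
  σ.cycleType.filter (fun l => d ∣ l) = {d}

open Module

/-! ### Spin relations in a ring -/

/-- The relations satisfied by the images of the generators of Schur's double cover of `S_n`
in a ring where the central element acts as `-1`. -/
structure SpinRel {R : Type*} [Ring R] (s : ℕ → R) (n : ℕ) : Prop where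
  sq : ∀ i, i + 1 < n → s i * s i = -1
  braid : ∀ i, i + 2 < n → s i * s (i + 1) * s i = s (i + 1) * s i * s (i + 1)
  far : ∀ i j, i + 2 ≤ j → j + 1 < n → s i * s j = -(s j * s i)

/-- Spin analogues of the Jucys–Murphy elements. -/
def jm {R : Type*} [Ring R] (s : ℕ → R) : ℕ → R
  | 0 => 0
  | k + 1 => s k + s k * jm s k * s k

namespace SpinRel

variable {R : Type*} [Ring R] {s : ℕ → R} {n : ℕ}

theorem mono (h : SpinRel s n) {m : ℕ} (hm : m ≤ n) : SpinRel s m :=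
  ⟨fun i hi => h.sq i (by omega), fun i hi => h.braid i (by omega),
    fun i j hi hj => h.far i j hi (by omega)⟩

theorem shift (h : SpinRel s n) (m : ℕ) : SpinRel (fun i => s (m + i)) (n - m) :=
  ⟨fun i hi => h.sq _ (by omega), fun i hi => h.braid (m + i) (by omega),
    fun i j hi hj => h.far _ _ (by omega) (by omega)⟩

theorem jm_anti_above (h : SpinRel s n) {k i : ℕ} (hk : k < i) (hi : i + 1 < n) :
    jm s k * s i = -(s i * jm s k) := by
  induction k with
  | zero => simp [jm]
  | succ k ih =>
    have h1 := ih (by omega)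
    have h2 := h.far k i (by omega) hi
    calc jm s (k + 1) * s i = s k * s i + s k * jm s k * (s k * s i) := by
          simp only [jm]; noncomm_ring
      _ = s k * s i - s k * (jm s k * s i) * s k := by rw [h2]; noncomm_ring
      _ = s k * s i + (s k * s i) * jm s k * s k := by rw [h1]; noncomm_ring
      _ = -(s i * jm s (k + 1)) := by rw [h2]; simp only [jm]; noncomm_ring

theorem jm_anti_below (h : SpinRel s n) {k i : ℕ} (hi : i + 2 ≤ k) (hk : k < n) :
    jm s k * s i = -(s i * jm s k) := by
  induction k with
  | zero => omega
  | succ k ih =>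
    rcases Nat.lt_or_ge k (i + 2) with hlt | hge
    · obtain rfl : k = i + 1 := by omega
      have hb := h.braid i (by omega)
      have hx := h.jm_anti_above (k := i) (i := i + 1) (by omega) (by omega)
      have q1 := h.sq i (by omega)
      have q2 := h.sq (i + 1) (by omega)
      simp only [jm]
      generalize s (i + 1) = b at *
      generalize s i = a at *
      generalize jm s i = x at *
      have e1 : b * a * b * a = -(a * b) := by
        rw [← hb, mul_assoc _ a a, q1]; simp
      have e2 : a * b * a * b = -(b * a) := by
        rw [hb, mul_assoc _ b b, q2]; simp
      have e3 : a * b * a * x * a * b = -(b * a * x * a * b * a) := by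
        calc a * b * a * x * a * b = b * a * (b * x) * a * b := by rw [hb]; noncomm_ring
          _ = -(b * a * x * (b * a * b)) := by
            rw [show b * x = -(x * b) by rw [hx]; simp]; noncomm_ring
          _ = _ := by rw [← hb]; noncomm_ring
      calc (b + b * (a + a * x * a) * b) * a
          = b * a + b * a * b * a + b * a * x * a * b * a := by noncomm_ring
        _ = -(a * b + a * b * a * b + a * b * a * x * a * b) := by
          rw [e1, e2, e3]; noncomm_ring
        _ = _ := by noncomm_ring
    · have h1 := ih hge (by omega)
      have h2 := h.far i k (by omega) hk
      have h3 : s k * s i = -(s i * s k) := by rw [h2]; simp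
      calc jm s (k + 1) * s i = s k * s i + s k * jm s k * (s k * s i) := by
            simp only [jm]; noncomm_ring
        _ = s k * s i - s k * (jm s k * s i) * s k := by rw [h3]; noncomm_ring
        _ = s k * s i + (s k * s i) * jm s k * s k := by rw [h1]; noncomm_ring
        _ = -(s i * jm s (k + 1)) := by rw [h3]; simp only [jm]; noncomm_ring

theorem jm_anti_lt (h : SpinRel s n) {j k : ℕ} (hj : j < k) (hk : k < n) :
    jm s j * jm s k = -(jm s k * jm s j) := by
  induction j with
  | zero => simp [jm]
  | succ j ih =>
    have h1 := ih (by omega)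
    have h3 : s j * jm s k = -(jm s k * s j) := by
      rw [h.jm_anti_below (by omega) hk]; simp
    calc jm s (j + 1) * jm s k = s j * jm s k + s j * jm s j * (s j * jm s k) := by
          simp only [jm]; noncomm_ring
      _ = s j * jm s k - s j * (jm s j * jm s k) * s j := by rw [h3]; noncomm_ring
      _ = s j * jm s k + (s j * jm s k) * jm s j * s j := by rw [h1]; noncomm_ring
      _ = -(jm s k * jm s (j + 1)) := by rw [h3]; simp only [jm]; noncomm_ring

theorem jm_anti (h : SpinRel s n) {j k : ℕ} (hjk : j ≠ k) (hj : j < n) (hk : k < n) :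
    jm s j * jm s k = -(jm s k * jm s j) := by
  rcases Nat.lt_or_gt_of_ne hjk with h1 | h1
  · exact h.jm_anti_lt h1 hk
  · rw [h.jm_anti_lt h1 hj]; simp

theorem jm_succ_mul (h : SpinRel s n) {k : ℕ} (hk : k + 1 < n) :
    jm s (k + 1) * s k + s k * jm s k = -1 := by
  simp only [jm, add_mul, mul_assoc, h.sq k hk]; simp

theorem jm_mul (h : SpinRel s n) {k : ℕ} (hk : k + 1 < n) :
    jm s k * s k + s k * jm s (k + 1) = -1 := by
  simp only [jm, mul_add, ← mul_assoc, h.sq k hk]; simp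

theorem sigma_quadratic (h : SpinRel s n) {i : ℕ} (hi : i + 2 < n) :
    (s i * s (i + 1) + s (i + 1) * s i + 2) * (s i * s (i + 1) + s (i + 1) * s i - 1) = 0 := by
  have hb := h.braid i hi
  have q1 := h.sq i (by omega)
  have q2 := h.sq (i + 1) (by omega)
  generalize s (i + 1) = b at *
  generalize s i = a at *
  have e1 : a * b * a * b = -(b * a) := by
    rw [hb, mul_assoc _ b b, q2]; simp
  have e2 : b * a * b * a = -(a * b) := by
    rw [← hb, mul_assoc _ a a, q1]; simp
  have e3 : a * b * b * a = 1 := by rw [mul_assoc a, q2]; simp [q1]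
  have e4 : b * a * a * b = 1 := by rw [mul_assoc b, q1]; simp [q2]
  calc _ = a * b * a * b + a * b * b * a + b * a * a * b + b * a * b * a + a * b + b * a - 2 := by
        noncomm_ring
    _ = 0 := by rw [e1, e2, e3, e4, ← one_add_one_eq_two]; noncomm_ring

theorem jm_two_sq (h : SpinRel s n) (hn : 2 < n) :
    jm s 2 * jm s 2 = -(s 0 * s 1 + s 1 * s 0 + 2) := by
  have q1 := h.sq 0 (by omega)
  have q2 := h.sq 1 (by omega)
  simp only [jm, mul_zero, zero_mul, add_zero]
  generalize s 1 = b at *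
  generalize s 0 = a at *
  calc (b + b * a * b) * (b + b * a * b)
      = b * b + (b * b) * a * b + b * a * (b * b) + b * a * (b * b) * a * b := by noncomm_ring
    _ = -1 - a * b - b * a - b * (a * a) * b := by rw [q2]; noncomm_ring
    _ = -1 - a * b - b * a + b * b := by rw [q1]; noncomm_ring
    _ = _ := by rw [q2, ← one_add_one_eq_two]; noncomm_ring

end SpinRel

/-! ### Linear algebra preliminaries -/

theorem finrank_iSupIndep_sum_le {K V ι : Type*} [Field K] [AddCommGroup V] [Module K V]
    [FiniteDimensional K V] {p : ι → Submodule K V} (h : iSupIndep p) (S : Finset ι) :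
    ∑ i ∈ S, finrank K (p i) ≤ finrank K V := by
  classical
  have h' : iSupIndep fun i : S => p i := h.comp Subtype.val_injective
  have := LinearMap.finrank_le_finrank_of_injective h'.dfinsupp_lsum_injective
  rw [← Finset.sum_coe_sort]
  refine le_trans (le_of_eq ?_) this
  exact (Module.finrank_directSum (R := K) (M := fun i : S => p i)).symm

theorem exists_joint_eigenvector {V : Type*} [AddCommGroup V] [Module ℂ V]
    [FiniteDimensional ℂ V] (f : ℕ → End ℂ V) (m : ℕ)
    (hc : ∀ i j, i < m → j < m → f i * f j = f j * f i)
    (U : Submodule ℂ V) (hU : U ≠ ⊥) (hst : ∀ i < m, ∀ v ∈ U, f i v ∈ U) :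
    ∃ v ∈ U, v ≠ 0 ∧ ∀ i < m, ∃ μ : ℂ, f i v = μ • v := by
  suffices H : ∀ k ≤ m, ∃ U' ≤ U, U' ≠ ⊥ ∧ (∀ i < m, ∀ v ∈ U', f i v ∈ U') ∧
      ∀ i < k, ∃ μ : ℂ, ∀ v ∈ U', f i v = μ • v by
    obtain ⟨U', hle, hne, -, he⟩ := H m le_rfl
    obtain ⟨v, hv, hv0⟩ := (Submodule.ne_bot_iff _).1 hne
    exact ⟨v, hle hv, hv0, fun i hi => (he i hi).imp fun μ h => h v hv⟩
  intro k
  induction k with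
  | zero => exact fun _ => ⟨U, le_rfl, hU, hst, by simp⟩
  | succ k ih =>
    intro hk
    obtain ⟨U', hle, hne, hst', he⟩ := ih (by omega)
    have : Nontrivial U' := Submodule.nontrivial_iff_ne_bot.2 hne
    obtain ⟨μ, hμ⟩ := Module.End.exists_eigenvalue ((f k).restrict (hst' k (by omega)))
    obtain ⟨⟨w, hw⟩, hwe, hw0⟩ := hμ.exists_hasEigenvector
    rw [Module.End.mem_eigenspace_iff] at hwe
    have hwe' : f k w = μ • w := congrArg Subtype.val hwe
    refine ⟨U' ⊓ (f k).eigenspace μ, inf_le_left.trans hle, ?_, ?_, ?_⟩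
    · refine (Submodule.ne_bot_iff _).2 ⟨w, ⟨hw, Module.End.mem_eigenspace_iff.2 hwe'⟩, ?_⟩
      exact fun h => hw0 (Subtype.ext h)
    · rintro i hi v ⟨h1, h2⟩
      refine ⟨hst' i hi v h1, Module.End.mem_eigenspace_iff.2 ?_⟩
      have h2' := Module.End.mem_eigenspace_iff.1 h2
      rw [← Module.End.mul_apply, hc k i (by omega) hi, Module.End.mul_apply, h2', map_smul]
    · intro i hi
      rcases Nat.lt_succ_iff_lt_or_eq.1 hi with h | rfl
      · exact (he i h).imp fun μ h v hv => h v hv.1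
      · exact ⟨μ, fun v hv => Module.End.mem_eigenspace_iff.1 hv.2⟩

/-- Pairwise anticommuting invertible operators force the dimension to be large. -/
theorem exists_stable_le_of_anticommute {V : Type*} [AddCommGroup V] [Module ℂ V]
    [FiniteDimensional ℂ V] {ι : Type*} (O : ι → End ℂ V) (q : ℕ) (e : ℕ → End ℂ V)
    (U : Submodule ℂ V) (hU : U ≠ ⊥)
    (he : ∀ i < 2 * q, ∀ v ∈ U, e i v ∈ U) (hO : ∀ o, ∀ v ∈ U, O o v ∈ U)
    (hsq : ∀ i < 2 * q, ∃ μ : ℂ, μ ≠ 0 ∧ ∀ v ∈ U, e i (e i v) = μ • v)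
    (hanti : ∀ i < 2 * q, ∀ j < 2 * q, i ≠ j → ∀ v ∈ U, e i (e j v) = -e j (e i v))
    (hantiO : ∀ i < 2 * q, ∀ o, ∀ v ∈ U, e i (O o v) = -O o (e i v)) :
    ∃ U' ≤ U, U' ≠ ⊥ ∧ (∀ o, ∀ v ∈ U', O o v ∈ U') ∧
      2 ^ q * finrank ℂ U' ≤ finrank ℂ U := by
  induction q generalizing e U with
  | zero => exact ⟨U, le_rfl, hU, hO, by simp⟩
  | succ q ih =>
    obtain ⟨l0, hl0, h00⟩ := hsq 0 (by omega)
    obtain ⟨l1, hl1, h11⟩ := hsq 1 (by omega)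
    have h01 := hanti 0 (by omega) 1 (by omega) (by simp)
    have s0 := he 0 (by omega)
    have s1 := he 1 (by omega)
    obtain ⟨μ, hμ⟩ : ∃ μ : ℂ, μ ^ 2 = -(l0 * l1) := IsAlgClosed.exists_pow_nat_eq _ (by norm_num)
    have hμ0 : μ ≠ 0 := by
      rintro rfl
      have : l0 * l1 = 0 := by linear_combination hμ
      simp_all
    let K : End ℂ V := e 0 * e 1
    let P : ℂ → Submodule ℂ V := fun ν => U ⊓ K.eigenspace ν
    have hP : ∀ ν v, v ∈ P ν ↔ v ∈ U ∧ e 0 (e 1 v) = ν • v := fun ν v => by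
      simp [P, K]
    have hswap : ∀ ν, ∀ v ∈ P ν, e 0 v ∈ P (-ν) := by
      intro ν v hv
      rw [hP] at hv ⊢
      refine ⟨s0 v hv.1, ?_⟩
      have : e 1 (e 0 v) = -(ν • v) := by rw [← hv.2, h01 v hv.1]; simp
      rw [this]; simp
    have hinj : ∀ v ∈ U, e 0 v = 0 → v = 0 := by
      intro v hv h
      have := h00 v hv
      rw [h, map_zero] at this
      exact (smul_eq_zero.1 this.symm).resolve_left hl0
    have hdimle : finrank ℂ (P μ) ≤ finrank ℂ (P (-μ)) := by
      refine LinearMap.finrank_le_finrank_of_injective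
        (f := (e 0).restrict (p := P μ) (q := P (-μ)) (hswap μ)) ?_
      rw [← LinearMap.ker_eq_bot, LinearMap.ker_eq_bot']
      rintro ⟨v, hv⟩ h
      exact Subtype.ext (hinj v hv.1 (congrArg Subtype.val h))
    have hdisj : Disjoint (P μ) (P (-μ)) := by
      rw [Submodule.disjoint_def]
      intro v h1 h2
      rw [hP] at h1 h2
      have : (2 * μ) • v = 0 := by
        rw [two_mul, add_smul]
        nth_rw 1 [← h1.2]
        rw [h2.2]; simp
      exact (smul_eq_zero.1 this).resolve_left (by simpa using hμ0)
    have hsum : 2 * finrank ℂ (P μ) ≤ finrank ℂ U := by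
      have h1 := Submodule.finrank_add_finrank_le_of_disjoint hdisj
      have h2 := Submodule.finrank_sup_add_finrank_inf_eq (P μ) (P (-μ))
      rw [hdisj.eq_bot, finrank_bot] at h2
      have h3 : finrank ℂ (P μ ⊔ P (-μ) : Submodule ℂ V) ≤ finrank ℂ U :=
        Submodule.finrank_mono (sup_le inf_le_left inf_le_left)
      omega
    have hne : P μ ≠ ⊥ := by
      obtain ⟨v, hv, hv0⟩ := (Submodule.ne_bot_iff _).1 hU
      have hKK : e 0 (e 1 (e 0 (e 1 v))) = μ ^ 2 • v := by
        have : e 1 (e 0 (e 1 v)) = -(l1 • e 0 v) := by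
          have := h01 (e 1 v) (s1 v hv)
          rw [h11 v hv, map_smul] at this
          rw [this]; simp
        rw [this, map_neg, map_smul, h00 v hv, hμ, smul_smul, neg_smul, mul_comm]
      have hw : e 0 (e 1 v) + μ • v ∈ P μ := by
        rw [hP]
        refine ⟨add_mem (s0 _ (s1 _ hv)) (U.smul_mem _ hv), ?_⟩
        rw [map_add, map_add, hKK, map_smul, map_smul, smul_add, smul_smul, sq, add_comm]
      by_cases hz : e 0 (e 1 v) + μ • v = 0
      · have hv' : v ∈ P (-μ) := by
          rw [hP]; exact ⟨hv, by rw [neg_smul]; exact eq_neg_of_add_eq_zero_left hz⟩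
        have := hswap _ _ hv'
        rw [neg_neg] at this
        exact (Submodule.ne_bot_iff _).2 ⟨_, this, fun h => hv0 (hinj v hv h)⟩
      · exact (Submodule.ne_bot_iff _).2 ⟨_, hw, hz⟩
    have hst : ∀ f : End ℂ V, (∀ v ∈ U, f v ∈ U) → (∀ v ∈ U, e 0 (f v) = -f (e 0 v)) →
        (∀ v ∈ U, e 1 (f v) = -f (e 1 v)) → ∀ v ∈ P μ, f v ∈ P μ := by
      intro f hf hf0 hf1 v hv
      rw [hP] at hv ⊢
      refine ⟨hf v hv.1, ?_⟩
      rw [hf1 v hv.1, map_neg, hf0 _ (s1 v hv.1), hv.2, map_smul]; simp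
    obtain ⟨U', hle, hne', hst', hfin⟩ := ih (fun i => e (i + 2)) (P μ) hne
      (fun i hi => hst _ (he _ (by omega)) (hanti 0 (by omega) _ (by omega) (by omega))
        (hanti 1 (by omega) _ (by omega) (by omega)))
      (fun o => hst _ (hO o) (hantiO 0 (by omega) o) (hantiO 1 (by omega) o))
      (fun i hi => (hsq (i + 2) (by omega)).imp fun l h => ⟨h.1, fun v hv => h.2 v hv.1⟩)
      (fun i hi j hj hij v hv => hanti _ (by omega) _ (by omega) (by omega) v hv.1)
      (fun i hi o v hv => hantiO _ (by omega) o v hv.1)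
    refine ⟨U', hle.trans inf_le_left, hne', hst', ?_⟩
    calc 2 ^ (q + 1) * finrank ℂ U' = 2 * (2 ^ q * finrank ℂ U') := by ring
      _ ≤ 2 * finrank ℂ (P μ) := by gcongr
      _ ≤ _ := hsum

/-! ### Weights of skew-adjoint spin modules -/

section Weights

variable {V : Type*} [NormedAddCommGroup V] [InnerProductSpace ℂ V]

/-- A skew-adjoint operator. -/
def IsSkew (x : End ℂ V) : Prop := ∀ v w, inner ℂ (x v) w = -inner ℂ v (x w)

theorem IsSkew.sub {x y : End ℂ V} (hx : IsSkew x) (hy : IsSkew y) : IsSkew (x - y) := by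
  intro v w
  simp only [LinearMap.sub_apply, inner_sub_left, inner_sub_right, hx v w, hy v w]; ring

theorem IsSkew.conj {x s : End ℂ V} (hs : IsSkew s) (hx : IsSkew x) :
    IsSkew (s + s * x * s) := by
  intro v w
  have h1 : inner ℂ (s (x (s v))) w = -inner ℂ v (s (x (s w))) := by
    rw [hs, hx, hs, neg_neg]
  simp only [LinearMap.add_apply, Module.End.mul_apply, inner_add_left, inner_add_right, hs v w, h1]
  ring

theorem IsSkew.inner_sq {x : End ℂ V} (hx : IsSkew x) (v : V) :
    inner ℂ v (x (x v)) = -((‖x v‖ : ℂ) ^ 2) := by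
  have := hx v (x v)
  rw [inner_self_eq_norm_sq_to_K] at this
  rw [← neg_eq_iff_eq_neg, ← this]; rfl

theorem IsSkew.eq_zero_of_sq {x : End ℂ V} (hx : IsSkew x) {v : V} (h : x (x v) = 0) :
    x v = 0 := by
  have := hx.inner_sq v
  rw [h, inner_zero_right] at this
  simpa using this.symm

theorem IsSkew.eigenvalue_real {x : End ℂ V} (hx : IsSkew x) {v : V} (hv : v ≠ 0) {a : ℂ}
    (h : x (x v) = a • v) : ∃ A : ℝ, a = -(A : ℂ) := by
  have := hx.inner_sq v
  rw [h, inner_smul_right, inner_self_eq_norm_sq_to_K] at this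
  have hn : (‖v‖ : ℂ) ≠ 0 := by simpa using hv
  refine ⟨‖x v‖ ^ 2 / ‖v‖ ^ 2, ?_⟩
  push_cast
  field_simp
  exact this

/-- Consecutive Jucys–Murphy type elements `x`, `y` linked by a generator `r`. -/
structure JMLink (x y r : End ℂ V) : Prop where
  sx : IsSkew x
  sy : IsSkew y
  sr : IsSkew r
  anti : x * y = -(y * x)
  sq : r * r = -1
  yr : y * r + r * x = -1
  xr : x * r + r * y = -1

namespace JMLink

variable {x y r : End ℂ V}

theorem anti_apply (h : JMLink x y r) (v : V) : x (y v) = -y (x v) :=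
  LinearMap.congr_fun h.anti v

theorem sq_apply (h : JMLink x y r) (v : V) : r (r v) = -v := LinearMap.congr_fun h.sq v

theorem y_r (h : JMLink x y r) (v : V) : y (r v) = -v - r (x v) :=
  eq_sub_of_add_eq (LinearMap.congr_fun h.yr v)

theorem x_r (h : JMLink x y r) (v : V) : x (r v) = -v - r (y v) :=
  eq_sub_of_add_eq (LinearMap.congr_fun h.xr v)

theorem xx_r (h : JMLink x y r) (v : V) : x (x (r v)) = r (y (y v)) + (y v - x v) := by
  rw [h.x_r, map_sub, map_neg, h.x_r]; abel

theorem yy_r (h : JMLink x y r) (v : V) : y (y (r v)) = r (x (x v)) + (x v - y v) := by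
  rw [h.y_r, map_sub, map_neg, h.y_r]; abel

theorem xx_y (h : JMLink x y r) (v : V) : x (x (y v)) = y (x (x v)) := by
  rw [h.anti_apply, map_neg, h.anti_apply, neg_neg]

theorem yy_x (h : JMLink x y r) (v : V) : y (y (x v)) = x (y (y v)) := by
  rw [h.anti_apply, h.anti_apply, map_neg, neg_neg]

theorem eigenvalue_ne (h : JMLink x y r) {v : V} (hv : v ≠ 0) {A B : ℝ}
    (ha : x (x v) = -(A : ℂ) • v) (hb : y (y v) = -(B : ℂ) • v) : A ≠ B := by
  rintro rfl
  set N : End ℂ V := y - x with hN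
  have hNs : IsSkew N := h.sy.sub h.sx
  have hxxN : x (x (N v)) = -(A : ℂ) • N v := by
    simp only [hN, LinearMap.sub_apply, map_sub, h.xx_y, ha, map_smul, smul_sub]
  have hN0 : N v = 0 := by
    have h1 : inner ℂ (x (x (r v))) (N v) = inner ℂ (r v) (x (x (N v))) := by
      rw [h.sx, h.sx, neg_neg]
    rw [hxxN, h.xx_r, hb, map_smul, inner_add_left, inner_smul_left, inner_smul_right] at h1
    have h2 : inner ℂ (N v) (N v) = 0 := by
      have : y v - x v = N v := rfl
      rw [this] at h1
      simpa using h1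
    exact inner_self_eq_zero.1 h2
  have hNN : N (N v) = -(2 * A : ℂ) • v := by
    have : N (N v) = y (y v) + x (x v) := by
      simp only [hN, LinearMap.sub_apply, map_sub, h.anti_apply]; abel
    rw [this, ha, hb]; module
  rw [hN0, map_zero] at hNN
  have hA : (A : ℂ) = 0 := by
    have := (smul_eq_zero.1 hNN.symm).resolve_right hv
    simpa using this
  rw [hA, neg_zero, zero_smul] at ha hb
  have hx0 := h.sx.eq_zero_of_sq ha
  have hy0 := h.sy.eq_zero_of_sq hb
  have h1 := h.y_r v
  rw [hx0, map_zero, sub_zero] at h1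
  have h2 := h.sy (r v) v
  rw [h1, hy0, inner_zero_right, inner_neg_left, neg_inj, inner_self_eq_zero] at h2
  exact hv h2

/-- The intertwiner exchanging two eigenvalues. -/
noncomputable def phi (x y r : End ℂ V) (A B : ℝ) : End ℂ V :=
  r + ((A - B : ℝ) : ℂ)⁻¹ • (y - x)

theorem phi_x (h : JMLink x y r) {v : V} {A B : ℝ} (hAB : A ≠ B)
    (ha : x (x v) = -(A : ℂ) • v) (hb : y (y v) = -(B : ℂ) • v) :
    x (x (phi x y r A B v)) = -(B : ℂ) • phi x y r A B v := by
  have hc : ((A : ℂ) - B) ≠ 0 := sub_ne_zero.2 (by exact_mod_cast hAB)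
  simp only [phi, LinearMap.add_apply, LinearMap.smul_apply, LinearMap.sub_apply, map_add, map_sub,
    map_smul, h.xx_r, h.xx_y, ha, hb]
  push_cast
  match_scalars <;> field_simp <;> ring

theorem phi_y (h : JMLink x y r) {v : V} {A B : ℝ} (hAB : A ≠ B)
    (ha : x (x v) = -(A : ℂ) • v) (hb : y (y v) = -(B : ℂ) • v) :
    y (y (phi x y r A B v)) = -(A : ℂ) • phi x y r A B v := by
  have hc : ((A : ℂ) - B) ≠ 0 := sub_ne_zero.2 (by exact_mod_cast hAB)
  simp only [phi, LinearMap.add_apply, LinearMap.smul_apply, LinearMap.sub_apply, map_add, map_sub,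
    map_smul, h.yy_r, h.yy_x, ha, hb]
  push_cast
  match_scalars <;> field_simp <;> ring

theorem phi_ne_zero (h : JMLink x y r) {v : V} (hv : v ≠ 0) {A B : ℝ} (hAB : A ≠ B)
    (ha : x (x v) = -(A : ℂ) • v) (hb : y (y v) = -(B : ℂ) • v) (hne : (A - B) ^ 2 ≠ A + B) :
    phi x y r A B v ≠ 0 := by
  intro h0
  have hc : ((A : ℂ) - B) ≠ 0 := sub_ne_zero.2 (by exact_mod_cast hAB)
  have h1 : phi x y r B A (phi x y r A B v) =
      (((A + B : ℝ) : ℂ) / ((A - B : ℝ) : ℂ) ^ 2 - 1) • v := by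
    have hd : (((B - A : ℝ) : ℂ))⁻¹ = -(((A - B : ℝ) : ℂ))⁻¹ := by
      rw [← inv_neg]; push_cast; ring
    simp only [phi, LinearMap.add_apply, LinearMap.smul_apply, LinearMap.sub_apply, map_add,
      map_sub, map_smul, h.sq_apply, h.x_r, h.y_r, h.anti_apply, ha, hb, hd]
    push_cast
    match_scalars <;> field_simp <;> ring
  rw [h0, map_zero] at h1
  have h2 := (smul_eq_zero.1 h1.symm).resolve_right hv
  rw [sub_eq_zero] at h2
  apply hne
  have hc' : ((A - B : ℝ) : ℂ) ≠ 0 := by exact_mod_cast hc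
  rw [div_eq_one_iff_eq (pow_ne_zero 2 hc')] at h2
  exact_mod_cast h2.symm

theorem apply_of_phi_eq_zero {v : V} {A B : ℝ} (h : phi x y r A B v = 0) :
    r v = ((A - B : ℝ) : ℂ)⁻¹ • (x v - y v) := by
  have := eq_neg_of_add_eq_zero_left h
  rw [this]
  simp only [LinearMap.smul_apply, LinearMap.sub_apply]
  module

/-- The pattern `A, B, A` of consecutive eigenvalues forces `A = 0`. -/
theorem eq_zero_of_pattern {w t : End ℂ V} (h : JMLink x y r) (h' : JMLink y w t)
    (hxw : x * w = -(w * x))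
    (hbraid : r * t * r = t * r * t)
    {A B : ℝ} (hA : 0 ≤ A) (hB : 0 ≤ B) (hAB : A ≠ B)
    (hphi : ∀ v, x (x v) = -(A : ℂ) • v → y (y v) = -(B : ℂ) • v → w (w v) = -(A : ℂ) • v →
      phi x y r A B v = 0 ∧ phi y w t B A v = 0)
    {v : V} (hv : v ≠ 0) (ha : x (x v) = -(A : ℂ) • v) (hb : y (y v) = -(B : ℂ) • v)
    (hc : w (w v) = -(A : ℂ) • v) : A = 0 := by
  have hxw' : ∀ u, x (w u) = -w (x u) := fun u => LinearMap.congr_fun hxw u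
  have hyw : ∀ u, y (w u) = -w (y u) := fun u => LinearMap.congr_fun h'.anti u
  have key := fun (u : V) h1 h2 h3 =>
    (⟨apply_of_phi_eq_zero (hphi u h1 h2 h3).1, apply_of_phi_eq_zero (hphi u h1 h2 h3).2⟩ :
      r u = ((A - B : ℝ) : ℂ)⁻¹ • (x u - y u) ∧ t u = ((B - A : ℝ) : ℂ)⁻¹ • (y u - w u))
  have hcc : ((A : ℂ) - B) ≠ 0 := sub_ne_zero.2 (by exact_mod_cast hAB)
  have hd : (((B - A : ℝ) : ℂ))⁻¹ = -(((A - B : ℝ) : ℂ))⁻¹ := by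
    rw [← inv_neg]; push_cast; ring
  set c : ℂ := ((A - B : ℝ) : ℂ)⁻¹ with hcdef
  have kv := key v ha hb hc
  have kx := key (x v) (by rw [ha, map_smul]) (by rw [h.yy_x, hb, map_smul])
    (by rw [show w (x v) = -x (w v) by rw [hxw']; simp, map_neg,
      show w (x (w v)) = -x (w (w v)) by (rw [hxw' (w v)]; simp), hc]; simp)
  have ky := key (y v) (by rw [h.xx_y, ha, map_smul]) (by rw [hb, map_smul])
    (by rw [h'.yy_x, hc, map_smul])
  have kw := key (w v) (by rw [hxw', map_neg, hxw', ha]; simp) (by rw [h'.xx_y, hb, map_smul])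
    (by rw [hc, map_smul])
  rw [hd] at kv kx ky kw
  have hwx : w (x v) = -x (w v) := by rw [hxw']; simp
  have hyx : y (x v) = -x (y v) := by rw [h.anti_apply]; simp
  have hwy : w (y v) = -y (w v) := by rw [hyw]; simp
  have e1 : c ^ 2 * (A + B) = 1 := by
    have h1 := h.sq_apply v
    rw [kv.1, map_smul, map_sub, kx.1, ky.1, ha, hb, hyx] at h1
    have : (c ^ 2 * (A + B) - 1) • v = 0 := by
      have h2 : (-(c ^ 2 * (A + B))) • v = -v := by
        rw [← h1]; module
      rw [sub_smul, one_smul, sub_eq_zero, ← neg_inj, ← h2, neg_smul]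
    exact sub_eq_zero.1 ((smul_eq_zero.1 this).resolve_right hv)
  have e2 : r (t v) + t (r v) = -(2 * c ^ 2 * B) • v := by
    rw [kv.1, kv.2]
    simp only [map_smul, map_sub, ky.1, ky.2, kw.1, kx.2, hwx, hyx, hwy, hb]
    module
  have hσ : (r * t + t * r + 2) * (r * t + t * r - 1) = 0 := by
    have e1 : r * t * r * t = -(t * r) := by rw [hbraid, mul_assoc _ t t, h'.sq]; simp
    have e2 : t * r * t * r = -(r * t) := by rw [← hbraid, mul_assoc _ r r, h.sq]; simp
    have e3 : r * t * t * r = 1 := by rw [mul_assoc r, h'.sq]; simp [h.sq]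
    have e4 : t * r * r * t = 1 := by rw [mul_assoc t, h.sq]; simp [h'.sq]
    calc _ = r * t * r * t + r * t * t * r + t * r * r * t + t * r * t * r + r * t + t * r - 2 := by
          noncomm_ring
      _ = 0 := by rw [e1, e2, e3, e4, ← one_add_one_eq_two]; noncomm_ring
  have hσv := LinearMap.congr_fun hσ v
  set k : ℂ := -(2 * c ^ 2 * B) with hk
  have hev : (r * t + t * r) v = k • v := e2
  have : ((k + 2) * (k - 1)) • v = 0 := by
    have h2 : ((r * t + t * r + 2) * (r * t + t * r - 1)) v = ((k + 2) * (k - 1)) • v := by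
      have : ((2 : End ℂ V)) v = (2 : ℂ) • v := by
        rw [show (2 : End ℂ V) = 1 + 1 from (one_add_one_eq_two).symm]
        simp [two_smul]
      rw [Module.End.mul_apply, LinearMap.sub_apply, hev, Module.End.one_apply, map_sub, map_smul,
        LinearMap.add_apply, hev, this]
      module
    rw [← h2, hσv]; rfl
  have hk2 := (smul_eq_zero.1 this).resolve_right hv
  have hcR : c ^ 2 = (((A + B : ℝ)) : ℂ)⁻¹ := by
    push_cast
    exact eq_inv_of_mul_eq_one_left e1
  have hABpos : 0 < A + B := by
    rcases lt_or_eq_of_le (add_nonneg hA hB) with h1 | h1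
    · exact h1
    · exfalso; apply hAB; linarith
  have hkR : k = ((-(2 * B / (A + B)) : ℝ) : ℂ) := by
    rw [hk, hcR]; push_cast; ring
  rw [hkR] at hk2
  have hk3 : (-(2 * B / (A + B)) + 2) * (-(2 * B / (A + B)) - 1) = 0 := by exact_mod_cast hk2
  rcases mul_eq_zero.1 hk3 with h1 | h1
  · field_simp at h1
    linarith
  · have : 0 ≤ 2 * B / (A + B) := by positivity
    linarith

end JMLink

end Weights

theorem sq_commute_sq_of_anti {R : Type*} [Ring R] {x y : R} (h : x * y = -(y * x)) :
    Commute (x * x) (y * y) := by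
  have : Commute (x * x) y := by
    calc x * x * y = x * (x * y) := mul_assoc _ _ _
      _ = -((x * y) * x) := by rw [mul_assoc x y x, h, mul_neg]
      _ = y * (x * x) := by rw [h]; noncomm_ring
  exact this.mul_right this

section Weights2

variable {V : Type*} [NormedAddCommGroup V] [InnerProductSpace ℂ V]
  {s : ℕ → End ℂ V} {n m : ℕ}

theorem IsSkew.jm (hs : ∀ i, i + 1 < n → IsSkew (s i)) {k : ℕ} (hk : k < n) :
    IsSkew (jm s k) := by
  induction k with
  | zero => intro v w; simp [_root_.jm]
  | succ k ih => exact (hs k hk).conj (ih (by omega))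

theorem SpinRel.jmLink (h : SpinRel s n) (hs : ∀ i, i + 1 < n → IsSkew (s i)) {k : ℕ}
    (hk : k + 1 < n) : JMLink (jm s k) (jm s (k + 1)) (s k) where
  sx := IsSkew.jm hs (by omega)
  sy := IsSkew.jm hs hk
  sr := hs k hk
  anti := h.jm_anti_lt (by omega) hk
  sq := h.sq k hk
  yr := h.jm_succ_mul hk
  xr := h.jm_mul hk

/-- `v` is a joint eigenvector of the squares of the first `m` Jucys–Murphy elements. -/
def IsWtVec (s : ℕ → End ℂ V) (m : ℕ) (A : ℕ → ℝ) (v : V) : Prop :=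
  ∀ j < m, jm s j (jm s j v) = -(A j : ℂ) • v

/-- `A` is a weight of the squares of the first `m` Jucys–Murphy elements. -/
def IsWt (s : ℕ → End ℂ V) (m : ℕ) (A : ℕ → ℝ) : Prop :=
  ∃ v, v ≠ 0 ∧ IsWtVec s m A v

namespace IsWt

variable {A : ℕ → ℝ}

theorem zero (hm : 0 < m) (hA : IsWt s m A) : A 0 = 0 := by
  obtain ⟨v, hv, h⟩ := hA
  have := h 0 hm
  simpa [jm, hv] using this

theorem one (h : SpinRel s n) (hmn : m ≤ n) (hm : 1 < m) (hA : IsWt s m A) : A 1 = 1 := by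
  obtain ⟨v, hv, hw⟩ := hA
  have := hw 1 hm
  have h0 : s 0 (s 0 v) = -v := LinearMap.congr_fun (h.sq 0 (by omega)) v
  simp only [jm, mul_zero, zero_mul, add_zero, h0, neg_smul, neg_inj] at this
  have h1 : ((A 1 : ℂ) - 1) • v = 0 := by rw [sub_smul, ← this, one_smul, sub_self]
  exact_mod_cast sub_eq_zero.1 ((smul_eq_zero.1 h1).resolve_right hv)

theorem nonneg (hs : ∀ i, i + 1 < n → IsSkew (s i)) (hmn : m ≤ n) (hA : IsWt s m A) {j : ℕ}
    (hj : j < m) : 0 ≤ A j := by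
  obtain ⟨v, hv, hw⟩ := hA
  have := (IsSkew.jm hs (show j < n by omega)).inner_sq v
  rw [hw j hj, inner_smul_right, inner_self_eq_norm_sq_to_K] at this
  have h2 : A j * ‖v‖ ^ 2 = ‖jm s j v‖ ^ 2 := by
    have : (A j : ℂ) * (‖v‖ : ℂ) ^ 2 = (‖jm s j v‖ : ℂ) ^ 2 := by
      rw [← neg_inj, ← this]; simp
    exact_mod_cast this
  have h3 : 0 < ‖v‖ ^ 2 := by positivity
  by_contra! hneg
  have := mul_neg_of_neg_of_pos hneg h3
  have := sq_nonneg ‖jm s j v‖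
  linarith

theorem ne_succ (h : SpinRel s n) (hs : ∀ i, i + 1 < n → IsSkew (s i)) (hmn : m ≤ n)
    (hA : IsWt s m A) {j : ℕ} (hj : j + 1 < m) : A j ≠ A (j + 1) := by
  obtain ⟨v, hv, hw⟩ := hA
  exact (h.jmLink hs (by omega)).eigenvalue_ne hv (hw j (by omega)) (hw (j + 1) hj)

theorem phi_isWtVec (h : SpinRel s n) (hs : ∀ i, i + 1 < n → IsSkew (s i)) (hmn : m ≤ n)
    {j : ℕ} (hj : j + 1 < m) {v : V} (hw : IsWtVec s m A v) (hne : A j ≠ A (j + 1)) :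
    IsWtVec s m (A ∘ Equiv.swap j (j + 1))
      (JMLink.phi (jm s j) (jm s (j + 1)) (s j) (A j) (A (j + 1)) v) := by
  have L := h.jmLink hs (k := j) (by omega)
  intro i hi
  rcases eq_or_ne i j with rfl | hij
  · simpa using L.phi_x hne (hw i hi) (hw (i + 1) hj)
  rcases eq_or_ne i (j + 1) with rfl | hij'
  · simpa using L.phi_y hne (hw j (by omega)) (hw (j + 1) hj)
  have hcs : jm s i * s j = -(s j * jm s i) := by
    rcases Nat.lt_or_ge i j with h1 | h1
    · exact h.jm_anti_above h1 (by omega)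
    · exact h.jm_anti_below (by omega) (by omega)
  have h1 := h.jm_anti hij (by omega) (by omega)
  have h2 := h.jm_anti hij' (by omega) (by omega)
  have c1 : ∀ u, jm s i (s j u) = -s j (jm s i u) := LinearMap.congr_fun hcs
  have c2 : ∀ u, jm s i (jm s j u) = -jm s j (jm s i u) := LinearMap.congr_fun h1
  have c3 : ∀ u, jm s i (jm s (j + 1) u) = -jm s (j + 1) (jm s i u) := LinearMap.congr_fun h2
  simp only [Function.comp, Equiv.swap_apply_of_ne_of_ne hij hij', JMLink.phi,
    LinearMap.add_apply, LinearMap.smul_apply, LinearMap.sub_apply, map_add, map_sub,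
    map_smul, map_neg, neg_neg, c1, c2, c3, hw i hi]
  module

theorem swap (h : SpinRel s n) (hs : ∀ i, i + 1 < n → IsSkew (s i)) (hmn : m ≤ n)
    (hA : IsWt s m A) {j : ℕ} (hj : j + 1 < m)
    (hne : (A j - A (j + 1)) ^ 2 ≠ A j + A (j + 1)) :
    IsWt s m (A ∘ Equiv.swap j (j + 1)) := by
  have h0 := hA.ne_succ h hs hmn hj
  obtain ⟨v, hv, hw⟩ := hA
  exact ⟨_, (h.jmLink hs (by omega)).phi_ne_zero hv h0 (hw j (by omega)) (hw (j + 1) hj) hne,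
    phi_isWtVec h hs hmn hj hw h0⟩

theorem pattern (h : SpinRel s n) (hs : ∀ i, i + 1 < n → IsSkew (s i)) (hmn : m ≤ n)
    (hA : IsWt s m A) {j : ℕ} (hj : j + 2 < m) (he : A (j + 2) = A j) : A j = 0 := by
  have h0 := hA.ne_succ h hs hmn (j := j) (by omega)
  have hn1 := hA.nonneg hs hmn (j := j) (by omega)
  have hn2 := hA.nonneg hs hmn (j := j + 1) (by omega)
  obtain ⟨v, hv, hw⟩ := hA
  have L := h.jmLink hs (k := j) (by omega)
  have L' := h.jmLink hs (k := j + 1) (by omega)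
  refine L.eq_zero_of_pattern L' (h.jm_anti_lt (j := j) (k := j + 2) (by omega) (by omega)) (h.braid j (by omega))
    hn1 hn2 h0 ?_ hv (hw j (by omega)) (hw (j + 1) (by omega)) (he ▸ hw (j + 2) hj)
  intro u h1 h2 h3
  constructor
  · by_contra hne
    have w1 := L.phi_y h0 h1 h2
    have w2 : jm s (j + 2) (jm s (j + 2) (JMLink.phi (jm s j) (jm s (j + 1)) (s j) (A j)
        (A (j + 1)) u)) = -(A j : ℂ) • JMLink.phi (jm s j) (jm s (j + 1)) (s j) (A j)
        (A (j + 1)) u := by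
      have c1 : ∀ u, jm s (j + 2) (s j u) = -s j (jm s (j + 2) u) :=
        LinearMap.congr_fun (h.jm_anti_below (k := j + 2) (i := j) (by omega) (by omega))
      have c2 : ∀ u, jm s (j + 2) (jm s j u) = -jm s j (jm s (j + 2) u) :=
        LinearMap.congr_fun (h.jm_anti (j := j + 2) (k := j) (by omega) (by omega) (by omega))
      have c3 : ∀ u, jm s (j + 2) (jm s (j + 1) u) = -jm s (j + 1) (jm s (j + 2) u) :=
        LinearMap.congr_fun (h.jm_anti (j := j + 2) (k := j + 1) (by omega) (by omega) (by omega))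
      simp only [JMLink.phi,
        LinearMap.add_apply, LinearMap.smul_apply, LinearMap.sub_apply, map_add, map_sub,
        map_smul, map_neg, neg_neg, c1, c2, c3, h3]
      module
    exact L'.eigenvalue_ne hne w1 w2 rfl
  · by_contra hne
    have w1 := L'.phi_x h0.symm h2 h3
    have w2 : jm s j (jm s j (JMLink.phi (jm s (j + 1)) (jm s (j + 2)) (s (j + 1)) (A (j + 1))
        (A j) u)) = -(A j : ℂ) • JMLink.phi (jm s (j + 1)) (jm s (j + 2)) (s (j + 1)) (A (j + 1))
        (A j) u := by
      have c1 : ∀ u, jm s j (s (j + 1) u) = -s (j + 1) (jm s j u) :=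
        LinearMap.congr_fun (h.jm_anti_above (k := j) (i := j + 1) (by omega) (by omega))
      have c2 : ∀ u, jm s j (jm s (j + 2) u) = -jm s (j + 2) (jm s j u) :=
        LinearMap.congr_fun (h.jm_anti (j := j) (k := j + 2) (by omega) (by omega) (by omega))
      have c3 : ∀ u, jm s j (jm s (j + 1) u) = -jm s (j + 1) (jm s j u) :=
        LinearMap.congr_fun (h.jm_anti (j := j) (k := j + 1) (by omega) (by omega) (by omega))
      simp only [JMLink.phi,
        LinearMap.add_apply, LinearMap.smul_apply, LinearMap.sub_apply, map_add, map_sub,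
        map_smul, map_neg, neg_neg, c1, c2, c3, h1]
      module
    exact L.eigenvalue_ne hne w2 w1 rfl

end IsWt

/-- Triangular numbers, as reals. -/
noncomputable def tri (q : ℕ) : ℝ := q * (q + 1) / 2

theorem tri_strictMono : StrictMono tri := by
  intro a b hab
  have : (a : ℝ) < b := by exact_mod_cast hab
  have : (0 : ℝ) ≤ a := by positivity
  unfold tri; nlinarith

theorem tri_ne {p q : ℕ} (h : p ≠ q) (h1 : p ≠ q + 1) (h2 : q ≠ p + 1) :
    (tri p - tri q) ^ 2 ≠ tri p + tri q := by
  wlog hpq : p < q generalizing p q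
  · rw [add_comm, sub_sq_comm]
    exact this h.symm h2 h1 (by omega)
  obtain ⟨d, rfl⟩ : ∃ d, q = p + 2 + d := ⟨q - p - 2, by omega⟩
  unfold tri
  push_cast
  have hp : (0 : ℝ) ≤ p := by positivity
  have hd : (0 : ℝ) ≤ d := by positivity
  have : (((p : ℝ) * (p + 1) / 2 - (p + 2 + d) * (p + 2 + d + 1) / 2) ^ 2) -
      ((p : ℝ) * (p + 1) / 2 + (p + 2 + d) * (p + 2 + d + 1) / 2) =
      (1 + d) * (3 + d) * (2 * p + 2 + d) * (2 * p + d + 4) / 4 := by ring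
  have h3 : 0 < ((1 : ℝ) + d) * (3 + d) * (2 * p + 2 + d) * (2 * p + d + 4) / 4 := by positivity
  intro h4
  linarith

theorem IsWt.exists_tri (h : SpinRel s n) (hs : ∀ i, i + 1 < n → IsSkew (s i)) (hmn : m ≤ n)
    {j : ℕ} (hj : j < m) {A : ℕ → ℝ} (hA : IsWt s m A) : ∃ q ≤ j, A j = tri q := by
  induction j generalizing A with
  | zero => exact ⟨0, le_rfl, by rw [hA.zero hj]; simp [tri]⟩
  | succ j ih =>
    by_cases hd : (A j - A (j + 1)) ^ 2 = A j + A (j + 1)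
    · obtain ⟨p, hp, hpA⟩ := ih (by omega) hA
      rw [hpA] at hd
      have : (A (j + 1) - tri (p + 1)) * (A (j + 1) - (tri p - p)) = 0 := by
        unfold tri at hd ⊢; push_cast; linear_combination hd
      rcases mul_eq_zero.1 this with h1 | h1
      · exact ⟨p + 1, by omega, by linarith⟩
      · refine ⟨p - 1, by omega, ?_⟩
        rw [sub_eq_zero] at h1
        rw [h1]
        cases p with
        | zero => simp [tri]
        | succ p => simp only [tri, Nat.add_sub_cancel]; push_cast; ring
    · obtain ⟨q, hq, hqA⟩ := ih (by omega) (hA.swap h hs hmn hj hd)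
      exact ⟨q, by omega, by simpa using hqA⟩

/-- The list of contents `l` is a weight. -/
def IsWord (s : ℕ → End ℂ V) (l : List ℕ) : Prop :=
  IsWt s l.length fun j => tri (l.getD j 0)

theorem SpinRel.exists_word [FiniteDimensional ℂ V] (h : SpinRel s n)
    (hs : ∀ i, i + 1 < n → IsSkew (s i)) (hmn : m ≤ n) (U : Submodule ℂ V) (hU : U ≠ ⊥)
    (hst : ∀ i < m, ∀ v ∈ U, jm s i (jm s i v) ∈ U) :
    ∃ l : List ℕ, l.length = m ∧ (∀ j < m, l.getD j 0 ≤ j) ∧ IsWord s l ∧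
      ∃ v ∈ U, v ≠ 0 ∧ ∀ j < m, jm s j (jm s j v) = -(tri (l.getD j 0) : ℂ) • v := by
  obtain ⟨v, hvU, hv, hev⟩ := exists_joint_eigenvector (fun j => jm s j * jm s j) m
    (fun i j hi hj => by
      rcases eq_or_ne i j with rfl | hij
      · rfl
      · have := h.jm_anti hij (by omega) (by omega)
        exact sq_commute_sq_of_anti this) U hU hst
  have hreal : ∀ j, ∃ A : ℝ, j < m → jm s j (jm s j v) = -(A : ℂ) • v := by
    intro j
    by_cases hj : j < m
    · obtain ⟨μ, hμ⟩ := hev j hj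
      obtain ⟨A, rfl⟩ := (IsSkew.jm hs (by omega)).eigenvalue_real hv hμ
      exact ⟨A, fun _ => hμ⟩
    · exact ⟨0, fun h => absurd h hj⟩
  choose A hA using hreal
  have hW : IsWt s m A := ⟨v, hv, hA⟩
  have htri : ∀ j, ∃ q, j < m → q ≤ j ∧ A j = tri q := by
    intro j
    by_cases hj : j < m
    · obtain ⟨q, hq⟩ := hW.exists_tri h hs hmn hj
      exact ⟨q, fun _ => hq⟩
    · exact ⟨0, fun h => absurd h hj⟩
  choose q hq using htri
  have hget : ∀ j < m, (List.ofFn fun i : Fin m => q i).getD j 0 = q j := by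
    intro j hj
    simp [hj]
  have hvec : ∀ j < m, jm s j (jm s j v) =
      -(tri ((List.ofFn fun i : Fin m => q i).getD j 0) : ℂ) • v := by
    intro j hj
    rw [hget j hj, ← (hq j hj).2]
    exact hA j hj
  refine ⟨List.ofFn fun i : Fin m => q i, by simp, fun j hj => ?_, ⟨v, hv, ?_⟩, v, hvU, hv, hvec⟩
  · rw [hget j hj]; exact (hq j hj).1
  · intro j hj
    exact hvec j (by simpa using hj)

end Weights2

/-! ### Enumeration of the weights of small spin symmetric groups -/

/-- Exchange the entries at positions `j` and `j + 1`. -/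
def swapAt (l : List ℕ) (j : ℕ) : List ℕ := (l.set j (l.getD (j + 1) 0)).set (j + 1) (l.getD j 0)

/-- The contents at positions `j` and `j + 1` may be exchanged. -/
def canSwap (l : List ℕ) (j : ℕ) : Bool :=
  l.getD j 0 != l.getD (j + 1) 0 && l.getD j 0 != l.getD (j + 1) 0 + 1 &&
    l.getD (j + 1) 0 != l.getD j 0 + 1

/-- Close a list of words under one round of admissible exchanges. -/
def grow (L : List (List ℕ)) : List (List ℕ) :=
  (L ++ L.flatMap fun l => ((List.range (l.length - 1)).filter (canSwap l)).map (swapAt l)).dedup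

/-- Words that cannot be weights for local reasons. -/
def isBad (l : List ℕ) : Bool :=
  l.getD 0 0 != 0 || (List.range (l.length - 1)).any fun j =>
    l.getD j 0 == l.getD (j + 1) 0 ||
      (decide (j + 2 < l.length) && l.getD j 0 == l.getD (j + 2) 0 && l.getD j 0 != 0)

/-- Words obtained by at most `k` admissible exchanges. -/
def reach : ℕ → List ℕ → List (List ℕ)
  | 0, l => [l]
  | k + 1, l => grow (reach k l)

/-- Words obtained by moving the letter at position `j` to the left as long as admissible. -/
def sift : ℕ → List ℕ → List (List ℕ)
  | 0, l => [l]
  | j + 1, l => l :: if canSwap l j then sift j (swapAt l j) else []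

/-- Words of length `m` all of whose prefixes pass the local test after moving the last letter
to the left. -/
def cands : ℕ → List (List ℕ)
  | 0 => [[]]
  | m + 1 => (cands m).flatMap fun l =>
      ((List.range (m + 1)).map fun x => l ++ [x]).filter fun l' => !(sift m l').any isBad

/-- Positions of the nonzero entries. -/
def nzIdx (l : List ℕ) : List ℕ := (List.range l.length).filter fun j => l.getD j 0 != 0

theorem cands_seven : ∀ l ∈ cands 7, l.getD 2 0 = 0 →
    5 ≤ (reach 4 l).length ∧ ∀ x ∈ reach 4 l, 4 ≤ (nzIdx x).length := by
  decide +kernel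

theorem cands_five : ∀ l ∈ cands 5, ∃ q ∈ List.range 3,
    4 ≤ (reach 2 l).length * 2 ^ q ∧ ∀ x ∈ reach 2 l, 2 * q ≤ (nzIdx x).length := by
  decide +kernel

theorem reach_nodup (k : ℕ) (l : List ℕ) : (reach k l).Nodup := by
  cases k with
  | zero => simp [reach]
  | succ k => exact List.nodup_dedup _

theorem swapAt_length (l : List ℕ) (j : ℕ) : (swapAt l j).length = l.length := by simp [swapAt]

theorem swapAt_getD (l : List ℕ) {j : ℕ} (hj : j + 1 < l.length) (i : ℕ) :
    (swapAt l j).getD i 0 = l.getD (Equiv.swap j (j + 1) i) 0 := by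
  simp only [swapAt, List.getD_eq_getElem?_getD, List.getElem?_set, List.length_set]
  rcases eq_or_ne i (j + 1) with rfl | h1
  · simp [hj]
  rcases eq_or_ne i j with rfl | h2
  · simp [show i < l.length by omega]
  · rw [Equiv.swap_apply_of_ne_of_ne h2 h1, if_neg h1.symm, if_neg h2.symm]

section Words

variable {V : Type*} [NormedAddCommGroup V] [InnerProductSpace ℂ V]
  {s : ℕ → End ℂ V} {n : ℕ}

theorem IsWord.swapAt (h : SpinRel s n) (hs : ∀ i, i + 1 < n → IsSkew (s i)) {l : List ℕ}
    (hl : l.length ≤ n) (hw : IsWord s l) {j : ℕ} (hj : j + 1 < l.length) (hc : canSwap l j) :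
    IsWord s (swapAt l j) := by
  simp only [canSwap, Bool.and_eq_true, bne_iff_ne] at hc
  have := IsWt.swap h hs hl hw hj (tri_ne hc.1.1 hc.1.2 hc.2)
  unfold IsWord
  rw [swapAt_length]
  refine Eq.mp ?_ this
  congr 1
  funext i
  rw [swapAt_getD l hj, Function.comp]

theorem IsWord.reach (h : SpinRel s n) (hs : ∀ i, i + 1 < n → IsSkew (s i)) {l : List ℕ}
    (hl : l.length ≤ n) (hw : IsWord s l) (k : ℕ) :
    ∀ x ∈ reach k l, x.length = l.length ∧ IsWord s x := by
  induction k with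
  | zero => simp [_root_.reach, hw]
  | succ k ih =>
    intro x hx
    simp only [_root_.reach, grow, List.mem_dedup, List.mem_append, List.mem_flatMap, List.mem_map,
      List.mem_filter, List.mem_range] at hx
    rcases hx with hx | ⟨y, hy, j, ⟨hj, hc⟩, rfl⟩
    · exact ih x hx
    · obtain ⟨h1, h2⟩ := ih y hy
      exact ⟨by rw [swapAt_length, h1], h2.swapAt h hs (by omega) (by omega) hc⟩

theorem IsWord.sift (h : SpinRel s n) (hs : ∀ i, i + 1 < n → IsSkew (s i)) (j : ℕ) {l : List ℕ}
    (hl : l.length ≤ n) (hw : IsWord s l) (hj : j < l.length) :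
    ∀ x ∈ sift j l, x.length = l.length ∧ IsWord s x := by
  induction j generalizing l with
  | zero => simp [_root_.sift, hw]
  | succ j ih =>
    intro x hx
    rw [_root_.sift, List.mem_cons] at hx
    rcases hx with rfl | hx
    · exact ⟨rfl, hw⟩
    · split_ifs at hx with hc
      · have := ih (l := _root_.swapAt l j) (by rwa [swapAt_length]) (hw.swapAt h hs hl hj hc)
          (by rw [swapAt_length]; omega) x hx
        rwa [swapAt_length] at this
      · simp at hx

theorem IsWord.not_isBad (h : SpinRel s n) (hs : ∀ i, i + 1 < n → IsSkew (s i)) {l : List ℕ}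
    (hl : l.length ≤ n) (hl0 : 0 < l.length) (hw : IsWord s l) : isBad l = false := by
  have tri0 : ∀ q, tri q = 0 → q = 0 := fun q hq =>
    tri_strictMono.injective (hq.trans (by simp [tri]))
  rw [Bool.eq_false_iff]
  intro hb
  simp only [isBad, Bool.or_eq_true, bne_iff_ne, List.any_eq_true, List.mem_range, beq_iff_eq,
    Bool.and_eq_true, decide_eq_true_eq] at hb
  rcases hb with hb | ⟨j, hj, hb | ⟨⟨h1, h2⟩, h3⟩⟩
  · exact hb (tri0 _ (IsWt.zero hl0 hw))
  · exact IsWt.ne_succ h hs hl hw (j := j) (by omega) (congrArg tri hb)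
  · exact h3 (tri0 _ (IsWt.pattern h hs hl hw h1 (congrArg tri h2.symm)))

theorem IsWord.mem_cands (h : SpinRel s n) (hs : ∀ i, i + 1 < n → IsSkew (s i))
    {l : List ℕ} (hl : l.length ≤ n) (hle : ∀ j < l.length, l.getD j 0 ≤ j) (hw : IsWord s l) :
    l ∈ cands l.length := by
  induction l using List.reverseRecOn with
  | nil => simp [cands]
  | append_singleton l x ih =>
    have hlen : (l ++ [x]).length = l.length + 1 := by simp
    have hget : ∀ j < l.length, (l ++ [x]).getD j 0 = l.getD j 0 := fun j hj => by
      simp [List.getElem?_append_left hj]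
    rw [hlen, cands]
    refine List.mem_flatMap.2 ⟨l, ih (by omega) ?_ ?_, List.mem_filter.2 ⟨?_, ?_⟩⟩
    · intro j hj
      rw [← hget j hj]; exact hle j (by omega)
    · obtain ⟨v, hv, hvw⟩ := hw
      refine ⟨v, hv, fun j hj => ?_⟩
      have := hvw j (by omega)
      simpa only [hget j hj] using this
    · have := hle l.length (by omega)
      have hx : (l ++ [x]).getD l.length 0 = x := by simp
      rw [hx] at this
      exact List.mem_map.2 ⟨x, List.mem_range.2 (by omega), rfl⟩
    · rw [Bool.not_eq_true', List.any_eq_false]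
      intro y hy
      obtain ⟨h1, h2⟩ := hw.sift h hs l.length hl (by omega) y hy
      rw [h2.not_isBad h hs (by omega) (by omega)]
      simp

theorem SpinRel.card_words_mul_le [FiniteDimensional ℂ V] (h : SpinRel s n) {m : ℕ}
    (hmn : m ≤ n) (L : List (List ℕ)) (hL : L.Nodup) (q g : ℕ)
    (hw : ∀ x ∈ L, x.length = m ∧ IsWord s x ∧ 2 * q ≤ (nzIdx x).length)
    (hg : ∀ U : Submodule ℂ V, U ≠ ⊥ → (∀ i, m ≤ i → i + 1 < n → ∀ v ∈ U, s i v ∈ U) →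
      g ≤ finrank ℂ U) : L.length * (2 ^ q * g) ≤ finrank ℂ V := by
  classical
  let f : Fin m → End ℂ V := fun j => jm s j * jm s j
  have hcomm : ∀ i j, Commute (f i) (f j) := by
    intro i j
    rcases eq_or_ne i j with rfl | hij
    · rfl
    · exact sq_commute_sq_of_anti
        (h.jm_anti (by simpa [Fin.ext_iff] using hij) (by omega) (by omega))
  let p : (Fin m → ℂ) → Submodule ℂ V := fun χ => ⨅ j, (f j).eigenspace (χ j)
  have hind : iSupIndep p := by
    refine (Module.End.independent_iInf_maxGenEigenspace_of_forall_mapsTo f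
      fun i j φ => Module.End.mapsTo_maxGenEigenspace_of_comm (hcomm j i) φ).mono ?_
    intro χ
    refine iInf_mono fun j => ?_
    exact Module.End.genEigenspace_le_maximal _ _ _
  have hmemp : ∀ χ v, v ∈ p χ ↔ ∀ j : Fin m, jm s j (jm s j v) = χ j • v := fun χ v => by
    simp [p, f]
  let wt : List ℕ → Fin m → ℂ := fun x j => -(tri (x.getD j 0) : ℂ)
  have hinj : Set.InjOn wt (L.toFinset : Set (List ℕ)) := by
    intro x hx y hy hxy
    rw [Finset.mem_coe, List.mem_toFinset] at hx hy
    have lx := (hw x hx).1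
    have ly := (hw y hy).1
    refine List.ext_getElem (by omega) fun j h1 h2 => ?_
    have := congrFun hxy ⟨j, by omega⟩
    simp only [wt, neg_inj] at this
    have := tri_strictMono.injective (Complex.ofReal_injective this)
    simpa [h1, h2] using this
  have hcard : (L.toFinset.image wt).card = L.length := by
    rw [Finset.card_image_of_injOn hinj, List.toFinset_card_of_nodup hL]
  refine le_trans ?_ (finrank_iSupIndep_sum_le hind (L.toFinset.image wt))
  rw [← hcard, ← smul_eq_mul]
  refine Finset.card_nsmul_le_sum _ _ _ ?_
  intro χ hχ
  obtain ⟨x, hx, rfl⟩ := Finset.mem_image.1 hχ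
  obtain ⟨lx, ⟨v, hv, hvx⟩, hnz⟩ := hw x (by simpa using hx)
  have hne : p (wt x) ≠ ⊥ := (Submodule.ne_bot_iff _).2
    ⟨v, (hmemp _ _).2 fun j => hvx j (by omega), hv⟩
  have hstab : ∀ e : End ℂ V, (∀ j < m, jm s j * e = e * jm s j ∨ jm s j * e = -(e * jm s j)) →
      ∀ v ∈ p (wt x), e v ∈ p (wt x) := by
    intro e he v hv
    rw [hmemp] at hv ⊢
    intro j
    have hc : jm s j (jm s j (e v)) = e (jm s j (jm s j v)) := by
      rcases he j j.2 with h1 | h1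
      · have h2 : ∀ u, jm s j (e u) = e (jm s j u) := LinearMap.congr_fun h1
        rw [h2, h2]
      · have h2 : ∀ u, jm s j (e u) = -e (jm s j u) := LinearMap.congr_fun h1
        rw [h2, map_neg, h2, neg_neg]
    rw [hc, hv, map_smul]
  have hnzm : ∀ i, (hi : i < (nzIdx x).length) → (nzIdx x)[i] < m ∧ x.getD (nzIdx x)[i] 0 ≠ 0 := by
    intro i hi
    have := List.getElem_mem hi
    simpa only [nzIdx, List.mem_filter, List.mem_range, lx, bne_iff_ne] using this
  have hnd : (nzIdx x).Nodup := List.nodup_range.filter _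
  have hgetD : ∀ i, (hi : i < 2 * q) → (nzIdx x).getD i 0 = (nzIdx x)[i]'(by omega) :=
    fun i hi => by simp [show i < (nzIdx x).length by omega]
  have hcA : ∀ i < 2 * q, ∀ j < 2 * q, i ≠ j → jm s ((nzIdx x).getD i 0) *
      jm s ((nzIdx x).getD j 0) = -(jm s ((nzIdx x).getD j 0) * jm s ((nzIdx x).getD i 0)) := by
    intro i hi j hj hij
    have b1 := (hnzm i (by omega)).1
    have b2 := (hnzm j (by omega)).1
    rw [hgetD i hi, hgetD j hj]
    refine h.jm_anti ?_ (by omega) (by omega)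
    exact fun he => hij ((hnd.getElem_inj_iff).1 he)
  obtain ⟨U', hle, hne', hst', hfin⟩ := exists_stable_le_of_anticommute
    (fun i : {i // m ≤ i ∧ i + 1 < n} => s i) q (fun i => jm s ((nzIdx x).getD i 0)) (p (wt x)) hne
    (by
      intro i hi
      have b1 := (hnzm i (by omega)).1
      refine hstab _ fun j hj => ?_
      rcases eq_or_ne j ((nzIdx x).getD i 0) with rfl | hne
      · exact Or.inl rfl
      · exact Or.inr (h.jm_anti hne (by omega) (by rw [hgetD i hi]; omega)))
    (by
      rintro ⟨i, h1, h2⟩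
      exact hstab (s i) fun j hj => Or.inr (h.jm_anti_above (by omega) h2))
    (by
      intro i hi
      have b1 := hnzm i (by omega)
      refine ⟨wt x ⟨(nzIdx x)[i], b1.1⟩, ?_, ?_⟩
      · simp only [wt, neg_ne_zero, Complex.ofReal_ne_zero]
        intro h0
        exact b1.2 (tri_strictMono.injective (h0.trans (by simp [tri])))
      · intro u hu
        rw [hgetD i hi]
        exact (hmemp _ _).1 hu ⟨_, b1.1⟩)
    (fun i hi j hj hij v _ => LinearMap.congr_fun (hcA i hi j hj hij) v)
    (by
      rintro i hi ⟨o, h1, h2⟩ v _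
      have b1 := (hnzm i (by omega)).1
      rw [hgetD i hi]
      exact LinearMap.congr_fun (h.jm_anti_above (by omega) h2) v)
  refine le_trans ?_ hfin
  gcongr
  exact hg U' hne' fun i h1 h2 => hst' ⟨i, h1, h2⟩

end Words

/-! ### Dimension bounds for spin modules -/

namespace SpinRel

section Basic

variable {R : Type*} [Ring R] {s : ℕ → R} {n : ℕ}

theorem basic_succ (h : SpinRel s n) {i : ℕ} (hi : i + 3 < n)
    (hb : s i * s (i + 1) + s (i + 1) * s i = 1) :
    s (i + 1) * s (i + 2) + s (i + 2) * s (i + 1) = 1 := by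
  have b1 := h.braid i (by omega)
  have b2 := h.braid (i + 1) (by omega)
  have f := h.far i (i + 2) (by omega) (by omega)
  have q1 := h.sq i (by omega)
  have q2 := h.sq (i + 1) (by omega)
  have q3 := h.sq (i + 2) (by omega)
  rw [show i + 1 + 1 = i + 2 from rfl] at b2
  generalize s (i + 2) = c at *
  generalize s (i + 1) = b at *
  generalize s i = a at *
  have f' : c * a = -(a * c) := by rw [f]; simp
  set w := a * b * c with hw
  have w1 : w * a = -(b * w) := by
    calc w * a = a * b * (c * a) := by rw [hw]; noncomm_ring
      _ = -(a * b * a) * c := by rw [f']; noncomm_ring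
      _ = -(b * w) := by rw [b1, hw]; noncomm_ring
  have w2 : w * b = -(c * w) := by
    calc w * b = a * (b * c * b) := by rw [hw]; noncomm_ring
      _ = (a * c) * b * c := by rw [b2]; noncomm_ring
      _ = -(c * w) := by rw [f, hw]; noncomm_ring
  have winv : w * (-(c * b * a)) = 1 := by
    calc w * (-(c * b * a)) = -(a * b * (c * c) * b * a) := by rw [hw]; noncomm_ring
      _ = a * (b * b) * a := by rw [q3]; noncomm_ring
      _ = 1 := by rw [q2]; simp [q1]
  have cw : c * w = -(w * b) := by rw [w2, neg_neg]
  have bw : b * w = -(w * a) := by rw [w1, neg_neg]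
  have key : (b * c + c * b) * w = w := by
    calc (b * c + c * b) * w = b * (c * w) + c * (b * w) := by noncomm_ring
      _ = b * -(w * b) + c * -(w * a) := by rw [cw, bw]
      _ = -((b * w) * b) - (c * w) * a := by noncomm_ring
      _ = w * (a * b + b * a) := by
        rw [cw, bw]; noncomm_ring
      _ = w := by rw [hb, mul_one]
  calc b * c + c * b = (b * c + c * b) * w * (-(c * b * a)) := by rw [mul_assoc, winv, mul_one]
    _ = 1 := by rw [key, winv]

theorem basic_all (h : SpinRel s n) (hb : s 0 * s 1 + s 1 * s 0 = 1) {i : ℕ} (hi : i + 2 < n) :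
    s i * s (i + 1) + s (i + 1) * s i = 1 := by
  induction i with
  | zero => exact hb
  | succ i ih => exact h.basic_succ (by omega) (ih (by omega))

theorem jm_basic (h : SpinRel s n) (hb : s 0 * s 1 + s 1 * s 0 = 1) {k : ℕ} (hk : k + 1 < n) :
    jm s k * s k + s k * jm s k = k ∧ jm s (k + 1) = jm s k + (k + 1) * s k := by
  have H : jm s k * s k + s k * jm s k = k → jm s (k + 1) = jm s k + (k + 1) * s k := by
    intro h1
    calc jm s (k + 1) = s k + (s k * jm s k) * s k := rfl
      _ = s k + (k - jm s k * s k) * s k := by rw [← h1]; noncomm_ring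
      _ = s k + k * s k - jm s k * (s k * s k) := by noncomm_ring
      _ = _ := by rw [h.sq k hk]; noncomm_ring
  suffices h1 : jm s k * s k + s k * jm s k = k from ⟨h1, H h1⟩
  clear H
  induction k with
  | zero => simp [jm]
  | succ k ih =>
    have h1 := ih (by omega)
    have h2 : jm s (k + 1) = jm s k + (k + 1) * s k := by
      calc jm s (k + 1) = s k + (s k * jm s k) * s k := rfl
        _ = s k + (k - jm s k * s k) * s k := by rw [← h1]; noncomm_ring
        _ = s k + k * s k - jm s k * (s k * s k) := by noncomm_ring
        _ = _ := by rw [h.sq k (by omega)]; noncomm_ring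
    have h3 := h.jm_anti_above (k := k) (i := k + 1) (by omega) (by omega)
    have h4 := h.basic_all hb (i := k) (by omega)
    have hc : s (k + 1) * ((k : R) + 1) = (k + 1) * s (k + 1) := by
      have := (Nat.cast_commute (k + 1) (s (k + 1))).eq
      push_cast at this
      exact this.symm
    rw [h2]
    calc (jm s k + (k + 1) * s k) * s (k + 1) + s (k + 1) * (jm s k + (k + 1) * s k)
        = jm s k * s (k + 1) + s (k + 1) * jm s k + (k + 1) * (s k * s (k + 1)) +
          (s (k + 1) * ((k : R) + 1)) * s k := by noncomm_ring
      _ = (k + 1) * (s k * s (k + 1) + s (k + 1) * s k) := by rw [h3, hc]; noncomm_ring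
      _ = _ := by rw [h4]; push_cast; simp

theorem jm_basic_sq (h : SpinRel s n) (hb : s 0 * s 1 + s 1 * s 0 = 1) {k : ℕ} (hk : k < n) :
    2 * (jm s k * jm s k) = -((k * (k + 1) : ℕ) : R) := by
  induction k with
  | zero => simp [jm]
  | succ k ih =>
    obtain ⟨h1, h2⟩ := h.jm_basic hb hk
    have hc : ∀ x : R, x * ((k : R) + 1) = (k + 1) * x := by
      intro x
      have := (Nat.cast_commute (k + 1) x).eq
      push_cast at this
      exact this.symm
    have h3 : jm s (k + 1) * jm s (k + 1) = jm s k * jm s k + (k + 1) * k - (k + 1) * (k + 1) := by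
      rw [h2]
      calc (jm s k + (k + 1) * s k) * (jm s k + (k + 1) * s k)
          = jm s k * jm s k + (jm s k * (k + 1)) * s k + (k + 1) * (s k * jm s k) +
            (k + 1) * (s k * (k + 1)) * s k := by noncomm_ring
        _ = jm s k * jm s k + (k + 1) * (jm s k * s k + s k * jm s k) +
            (k + 1) * (k + 1) * (s k * s k) := by rw [hc, hc]; noncomm_ring
        _ = _ := by rw [h1, h.sq k hk]; noncomm_ring
    have h4 := ih (by omega)
    rw [h3, mul_sub, mul_add, h4]
    have : (k : R) * k = ((k * k : ℕ) : R) := by push_cast; rfl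
    push_cast
    simp only [mul_add, add_mul, mul_one, one_mul, this, ← one_add_one_eq_two]
    abel

end Basic

variable {V : Type*} [NormedAddCommGroup V] [InnerProductSpace ℂ V] [FiniteDimensional ℂ V]
  {s : ℕ → End ℂ V} {n : ℕ}

theorem le_finrank_of_basic [Nontrivial V] (h : SpinRel s n) (hb : s 0 * s 1 + s 1 * s 0 = 1) :
    2 ^ ((n - 1) / 2) ≤ finrank ℂ V := by
  obtain ⟨U', -, hne, -, hfin⟩ := exists_stable_le_of_anticommute
    (fun i : Empty => (i.elim : End ℂ V)) ((n - 1) / 2) (fun i => jm s (i + 1)) ⊤ top_ne_bot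
    (fun _ _ _ _ => trivial) (fun o => o.elim)
    (by
      intro i hi
      refine ⟨-(((i + 1) * (i + 1 + 1) : ℕ) : ℂ) / 2, ?_, fun v _ => ?_⟩
      · rw [div_ne_zero_iff]
        exact ⟨neg_ne_zero.2 (Nat.cast_ne_zero.2 (by positivity)), two_ne_zero⟩
      · have h1 := LinearMap.congr_fun (h.jm_basic_sq hb (k := i + 1) (by omega)) v
        have h2 : (2 : ℂ) • jm s (i + 1) (jm s (i + 1) v) =
            -(((i + 1) * (i + 1 + 1) : ℕ) : ℂ) • v := by
          generalize (i + 1) * (i + 1 + 1) = N at h1 ⊢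
          rw [two_mul, LinearMap.add_apply, LinearMap.neg_apply, Module.End.natCast_apply] at h1
          rw [two_smul, neg_smul, Nat.cast_smul_eq_nsmul]
          exact h1
        rw [div_eq_inv_mul, mul_smul, ← h2, smul_smul]; norm_num)
    (fun i hi j hj hij v _ =>
      LinearMap.congr_fun (h.jm_anti (j := i + 1) (k := j + 1) (by omega) (by omega) (by omega)) v)
    (fun _ _ o => o.elim)
  have h1 : 1 ≤ finrank ℂ U' := by
    have : Nontrivial U' := Submodule.nontrivial_iff_ne_bot.2 hne
    exact finrank_pos
  rw [finrank_top] at hfin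
  exact (Nat.le_mul_of_pos_right _ h1).trans hfin

end SpinRel

/-- The lower bounds for the dimension of a skew-adjoint spin module of `S_n`. -/
def SpinBound (n : ℕ) : Prop :=
  ∀ (V : Type) [NormedAddCommGroup V] [InnerProductSpace ℂ V] [FiniteDimensional ℂ V]
    [Nontrivial V] (s : ℕ → End ℂ V), SpinRel s n → (∀ i, i + 1 < n → IsSkew (s i)) →
    (n ≠ 3 → 2 ^ ((n - 1) / 2) ≤ finrank ℂ V) ∧
    (7 ≤ n → s 0 * s 1 + s 1 * s 0 ≠ 1 → 2 ^ ((n - 1) / 2) < finrank ℂ V)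

theorem SpinBound.submodule {m n : ℕ} (hQ : SpinBound (n - m)) (h3 : n - m ≠ 3)
    {V : Type} [NormedAddCommGroup V] [InnerProductSpace ℂ V] [FiniteDimensional ℂ V]
    {s : ℕ → End ℂ V} (h : SpinRel s n) (hs : ∀ i, i + 1 < n → IsSkew (s i))
    (U : Submodule ℂ V) (hU : U ≠ ⊥) (hst : ∀ i, m ≤ i → i + 1 < n → ∀ v ∈ U, s i v ∈ U) :
    2 ^ ((n - m - 1) / 2) ≤ finrank ℂ U := by
  have : Nontrivial U := Submodule.nontrivial_iff_ne_bot.2 hU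
  let s' : ℕ → End ℂ U := fun i =>
    if hi : i + 1 < n - m then (s (m + i)).restrict (hst (m + i) (by omega) (by omega)) else 0
  have hs' : ∀ i, i + 1 < n - m → ∀ v : U, (s' i v : V) = s (m + i) v := by
    intro i hi v
    simp only [s', dif_pos hi]; rfl
  have hsh := h.shift m
  refine (hQ U s' ⟨?_, ?_, ?_⟩ ?_).1 h3
  · intro i hi
    ext v
    simpa [hs', hi] using LinearMap.congr_fun (hsh.sq i hi) (v : V)
  · intro i hi
    ext v
    simpa [hs', hi, show i + 1 < n - m by omega, show i + 1 + 1 < n - m by omega] using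
      LinearMap.congr_fun (hsh.braid i hi) (v : V)
  · intro i j hi hj
    ext v
    simpa [hs', hj, show i + 1 < n - m by omega] using
      LinearMap.congr_fun (hsh.far i j hi hj) (v : V)
  · intro i hi v w
    have := hs (m + i) (by omega) v w
    rw [Submodule.coe_inner, Submodule.coe_inner, hs' i hi, hs' i hi]
    exact this

theorem spinBound (n : ℕ) : SpinBound n := by
  induction n using Nat.strong_induction_on with
  | _ n ih =>
  intro V _ _ _ _ s h hs
  have hpos : 1 ≤ finrank ℂ V := finrank_pos
  have htop : ∀ m, ∀ i < m, ∀ v ∈ (⊤ : Submodule ℂ V), jm s i (jm s i v) ∈ (⊤ : Submodule ℂ V) :=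
    fun _ _ _ _ _ => trivial
  have hodd : n % 2 = 1 → 7 ≤ n → s 0 * s 1 + s 1 * s 0 ≠ 1 →
      2 ^ ((n - 1) / 2) < finrank ℂ V := by
    intro hn hn7 hb
    have hker : LinearMap.ker (jm s 2 * jm s 2) ≠ ⊥ := by
      intro hbot
      have h1 : jm s 2 * jm s 2 * (s 0 * s 1 + s 1 * s 0 - 1) = 0 := by
        rw [h.jm_two_sq (by omega), neg_mul, h.sigma_quadratic (by omega), neg_zero]
      apply hb
      rw [← sub_eq_zero]
      ext v
      have h2 : (s 0 * s 1 + s 1 * s 0 - 1) v ∈ LinearMap.ker (jm s 2 * jm s 2) :=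
        LinearMap.congr_fun h1 v
      rw [hbot] at h2
      exact h2
    obtain ⟨l, hl, hle, hw, v, hvU, hv, hvw⟩ := h.exists_word hs (m := 7) hn7 _ hker (by
      intro i hi v hv
      have hcomm : Commute (jm s 2 * jm s 2) (jm s i * jm s i) := by
        rcases eq_or_ne i 2 with rfl | hi2
        · rfl
        · exact sq_commute_sq_of_anti (h.jm_anti hi2.symm (by omega) (by omega))
      rw [LinearMap.mem_ker] at hv ⊢
      have := LinearMap.congr_fun hcomm.eq v
      change (jm s 2 * jm s 2) ((jm s i * jm s i) v) = (jm s i * jm s i) ((jm s 2 * jm s 2) v)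
        at this
      rw [hv, map_zero] at this
      exact this)
    have h2 : l.getD 2 0 = 0 := by
      have h3 := hvw 2 (by norm_num)
      have h4 : jm s 2 (jm s 2 v) = 0 := hvU
      rw [h4, eq_comm, smul_eq_zero, neg_eq_zero, Complex.ofReal_eq_zero] at h3
      exact tri_strictMono.injective ((h3.resolve_right hv).trans (by simp [tri]))
    have hmem := hw.mem_cands h hs (by omega) (by rwa [hl])
    rw [hl] at hmem
    obtain ⟨c1, c2⟩ := cands_seven l hmem h2
    have hcount := h.card_words_mul_le hn7 (reach 4 l) (reach_nodup _ _) 2 (2 ^ ((n - 7 - 1) / 2))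
      (fun x hx => by
        obtain ⟨r1, r2⟩ := hw.reach h hs (by omega) 4 x hx
        exact ⟨r1.trans hl, r2, c2 x hx⟩)
      (fun U hU hst => (ih (n - 7) (by omega)).submodule (by omega) h hs U hU hst)
    refine lt_of_lt_of_le ?_ hcount
    have hexp : 2 ^ ((n - 1) / 2) ≤ 2 ^ 4 * 2 ^ ((n - 7 - 1) / 2) := by
      rw [← pow_add]
      exact Nat.pow_le_pow_right (by norm_num) (by omega)
    have : 0 < 2 ^ ((n - 7 - 1) / 2) := by positivity
    calc _ ≤ 2 ^ 4 * 2 ^ ((n - 7 - 1) / 2) := hexp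
      _ < 5 * (2 ^ 2 * 2 ^ ((n - 7 - 1) / 2)) := by omega
      _ ≤ _ := by gcongr
  have hprev : 0 < n → n % 2 = 0 → (n - 1 ≠ 3 → 2 ^ ((n - 1) / 2) ≤ finrank ℂ V) ∧
      (8 ≤ n → s 0 * s 1 + s 1 * s 0 ≠ 1 → 2 ^ ((n - 1) / 2) < finrank ℂ V) := by
    intro h0 he
    have := ih (n - 1) (by omega) V s (h.mono (by omega)) (fun i hi => hs i (by omega))
    rw [show (n - 1 - 1) / 2 = (n - 1) / 2 by omega] at this
    exact ⟨this.1, fun h8 => this.2 (by omega)⟩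
  constructor
  · intro hn3
    rcases Nat.lt_or_ge n 3 with hn | hn
    · rw [show (n - 1) / 2 = 0 by omega]; exact hpos
    rcases eq_or_ne n 4 with rfl | hn4
    · obtain ⟨U', -, hne, -, hfin⟩ := exists_stable_le_of_anticommute
        (fun i : Empty => (i.elim : End ℂ V)) 1 (fun i => s (2 * i)) ⊤ top_ne_bot
        (fun _ _ _ _ => trivial) (fun o => o.elim)
        (fun i hi => ⟨-1, by norm_num, fun v _ => by
          rw [neg_smul, one_smul]; exact LinearMap.congr_fun (h.sq (2 * i) (by omega)) v⟩)
        (fun i hi j hj hij v _ => by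
          rcases Nat.lt_or_gt_of_ne hij with h1 | h1
          · exact LinearMap.congr_fun (h.far (2 * i) (2 * j) (by omega) (by omega)) v
          · have := LinearMap.congr_fun (h.far (2 * j) (2 * i) (by omega) (by omega)) v
            exact (neg_eq_iff_eq_neg.2 this).symm)
        (fun _ _ o => o.elim)
      have h1 : 1 ≤ finrank ℂ U' := by
        have : Nontrivial U' := Submodule.nontrivial_iff_ne_bot.2 hne
        exact finrank_pos
      rw [finrank_top] at hfin
      norm_num at hfin ⊢
      omega
    rcases Nat.mod_two_eq_zero_or_one n with hm | hm
    · exact (hprev (by omega) hm).1 (by omega)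
    rcases eq_or_ne n 5 with rfl | hn5
    · obtain ⟨l, hl, hle, hw, -⟩ := h.exists_word hs (m := 5) le_rfl ⊤ top_ne_bot (htop 5)
      have hmem := hw.mem_cands h hs (by omega) (by rwa [hl])
      rw [hl] at hmem
      obtain ⟨q, -, c1, c2⟩ := cands_five l hmem
      have hcount := h.card_words_mul_le le_rfl (reach 2 l) (reach_nodup _ _) q 1
        (fun x hx => by
          obtain ⟨r1, r2⟩ := hw.reach h hs (by omega) 2 x hx
          exact ⟨r1.trans hl, r2, c2 x hx⟩)
        (fun U hU _ => by
          have : Nontrivial U := Submodule.nontrivial_iff_ne_bot.2 hU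
          exact finrank_pos)
      rw [mul_one] at hcount
      exact c1.trans hcount
    by_cases hb : s 0 * s 1 + s 1 * s 0 = 1
    · exact h.le_finrank_of_basic hb
    · exact (hodd hm (by omega) hb).le
  · intro hn7 hb
    rcases Nat.mod_two_eq_zero_or_one n with hm | hm
    · exact (hprev (by omega) hm).2 (by omega) hb
    · exact hodd hm hn7 hb

/-! ### Clifford frames and lifts of permutations -/

section Frame

set_option linter.unusedSectionVars false

variable {V : Type*} [NormedAddCommGroup V] [InnerProductSpace ℂ V] [FiniteDimensional ℂ V]
  {ι : Type*} [Fintype ι] [DecidableEq ι]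

/-- An irreducible system of skew-adjoint Clifford generators indexed by the functions on `ι`
with zero sum. -/
structure SpinFrame (Γ : (ι → ℝ) → End ℂ V) : Prop where
  add : ∀ f g, Γ (f + g) = Γ f + Γ g
  smul : ∀ (r : ℝ) f, Γ (r • f) = (r : ℂ) • Γ f
  adjoint : ∀ f, ∑ i, f i = 0 → LinearMap.adjoint (Γ f) = -Γ f
  rel : ∀ f g, ∑ i, f i = 0 → ∑ i, g i = 0 →
    Γ f * Γ g + Γ g * Γ f = (-((∑ i, f i * g i : ℝ) : ℂ)) • 1
  scalar : ∀ X : End ℂ V, (∀ f, ∑ i, f i = 0 → X * Γ f = Γ f * X) → ∃ c : ℂ, X = c • 1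

/-- The sign of a permutation as a complex number. -/
def csign (ψ : Equiv.Perm ι) : ℂ := ((Equiv.Perm.sign ψ : ℤˣ) : ℤ)

theorem csign_mul (ψ χ : Equiv.Perm ι) : csign (ψ * χ) = csign ψ * csign χ := by
  simp [csign]

theorem csign_inv (ψ : Equiv.Perm ι) : csign ψ⁻¹ = csign ψ := by simp [csign]

theorem csign_one : csign (1 : Equiv.Perm ι) = 1 := by simp [csign]

theorem csign_swap {a b : ι} (h : a ≠ b) : csign (Equiv.swap a b) = -1 := by
  simp [csign, Equiv.Perm.sign_swap h]

theorem csign_eq (ψ : Equiv.Perm ι) : csign ψ = 1 ∨ csign ψ = -1 := by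
  rcases Int.units_eq_one_or (Equiv.Perm.sign ψ) with h | h <;> simp [csign, h]

theorem csign_mul_self (ψ : Equiv.Perm ι) : csign ψ * csign ψ = 1 := by
  rcases csign_eq ψ with h | h <;> simp [h]

/-- A unitary operator permuting the frame, up to sign, according to `ψ`. -/
structure IsLift (Γ : (ι → ℝ) → End ℂ V) (ψ : Equiv.Perm ι) (X : End ℂ V) : Prop where
  comm : ∀ f, ∑ i, f i = 0 → X * Γ f = csign ψ • (Γ (f ∘ ⇑ψ⁻¹) * X)
  unit : LinearMap.adjoint X * X = 1

/-- The difference `e_a - e_b` of standard basis vectors. -/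
def rootVec (a b : ι) : ι → ℝ := Pi.single a 1 - Pi.single b 1

theorem sum_rootVec (a b : ι) : ∑ i, rootVec a b i = 0 := by
  simp [rootVec]

theorem sum_mul_rootVec (f : ι → ℝ) (a b : ι) : ∑ i, rootVec a b i * f i = f a - f b := by
  simp [rootVec, sub_mul, Finset.sum_sub_distrib, Pi.single_apply]

theorem comp_swap_eq (f : ι → ℝ) (a b : ι) :
    f ∘ ⇑(Equiv.swap a b)⁻¹ = f + (-(f a - f b)) • rootVec a b := by
  ext i
  simp only [Equiv.swap_inv, Function.comp, Pi.add_apply, Pi.smul_apply, rootVec, Pi.sub_apply,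
    Pi.single_apply, smul_eq_mul]
  rcases eq_or_ne i a with rfl | ha
  · rcases eq_or_ne i b with rfl | hb
    · simp
    · simp [hb]
  · rcases eq_or_ne i b with rfl | hb
    · simp [ha]
    · simp [ha, hb, Equiv.swap_apply_of_ne_of_ne ha hb]

theorem sum_comp_perm {f : ι → ℝ} (hf : ∑ i, f i = 0) (ψ : Equiv.Perm ι) :
    ∑ i, (f ∘ ⇑ψ) i = 0 := by
  rw [← hf]; exact Equiv.sum_comp ψ f

theorem rootVec_comp (ψ : Equiv.Perm ι) (a b : ι) :
    rootVec a b ∘ ⇑ψ⁻¹ = rootVec (ψ a) (ψ b) := by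
  ext i
  simp only [rootVec, Function.comp, Pi.sub_apply, Pi.single_apply, Equiv.Perm.inv_eq_iff_eq]

theorem rootVec_sub (a b c : ι) : rootVec a b + (-1 : ℝ) • rootVec a c = rootVec c b := by
  simp only [rootVec]; module

variable {Γ : (ι → ℝ) → End ℂ V} {ψ χ : Equiv.Perm ι} {X Y : End ℂ V}

theorem SpinFrame.sq (h : SpinFrame Γ) {f : ι → ℝ} (hf : ∑ i, f i = 0) :
    Γ f * Γ f = (-((∑ i, f i * f i : ℝ) : ℂ) / 2) • 1 := by
  have := h.rel f f hf hf
  rw [← two_smul ℂ] at this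
  rw [div_eq_inv_mul, mul_smul, ← this, smul_smul]; norm_num

theorem SpinFrame.root_sq (h : SpinFrame Γ) {a b : ι} (hab : a ≠ b) :
    Γ (rootVec a b) * Γ (rootVec a b) = -1 := by
  rw [h.sq (sum_rootVec a b), sum_mul_rootVec]
  simp [rootVec, hab, hab.symm]

namespace IsLift

theorem one : IsLift Γ 1 1 := ⟨fun f _ => by simp [csign_one], by
  rw [mul_one]; exact LinearMap.adjoint_id⟩

theorem mul (hX : IsLift Γ ψ X) (hY : IsLift Γ χ Y) : IsLift Γ (ψ * χ) (X * Y) := by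
  refine ⟨fun f hf => ?_, ?_⟩
  · rw [mul_assoc, hY.comm f hf, mul_smul_comm, ← mul_assoc, hX.comm _ (sum_comp_perm hf _),
      smul_mul_assoc, smul_smul, csign_mul, mul_comm (csign χ), mul_assoc, mul_inv_rev]
    rfl
  · have : LinearMap.adjoint (X * Y) = LinearMap.adjoint Y * LinearMap.adjoint X :=
      LinearMap.adjoint_comp X Y
    rw [this, mul_assoc, ← mul_assoc _ X, hX.unit, one_mul, hY.unit]

theorem pow (hX : IsLift Γ ψ X) (j : ℕ) : IsLift Γ (ψ ^ j) (X ^ j) := by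
  induction j with
  | zero => simpa using one
  | succ j ih => rw [pow_succ, pow_succ]; exact ih.mul hX

theorem unit' (hX : IsLift Γ ψ X) : X * LinearMap.adjoint X = 1 :=
  mul_eq_one_comm.1 hX.unit

theorem adjoint (hX : IsLift Γ ψ X) : IsLift Γ ψ⁻¹ (LinearMap.adjoint X) := by
  refine ⟨fun f hf => ?_, by rw [LinearMap.adjoint_adjoint, hX.unit']⟩
  have h1 := hX.comm (f ∘ ⇑ψ) (sum_comp_perm hf ψ)
  have h2 : (f ∘ ⇑ψ) ∘ ⇑ψ⁻¹ = f := by ext; simp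
  rw [h2] at h1
  rw [inv_inv, csign_inv]
  calc LinearMap.adjoint X * Γ f
      = LinearMap.adjoint X * (csign ψ • (csign ψ • (Γ f * X))) * LinearMap.adjoint X := by
        rw [smul_smul, csign_mul_self, one_smul, mul_assoc, mul_assoc, hX.unit', mul_one]
    _ = csign ψ • (LinearMap.adjoint X * X * Γ (f ∘ ⇑ψ) * LinearMap.adjoint X) := by
        rw [← h1]; simp only [mul_smul_comm, smul_mul_assoc, mul_assoc]
    _ = _ := by rw [hX.unit, one_mul]

theorem smul (hX : IsLift Γ ψ X) {c : ℂ} (hc : ‖c‖ = 1) : IsLift Γ ψ (c • X) := by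
  refine ⟨fun f hf => ?_, ?_⟩
  · rw [smul_mul_assoc, hX.comm f hf, mul_smul_comm, smul_comm]
  · rw [map_smulₛₗ, smul_mul_smul_comm, hX.unit, ← Complex.normSq_eq_conj_mul_self,
      Complex.normSq_eq_norm_sq, hc]
    simp

theorem root (h : SpinFrame Γ) {a b : ι} (hab : a ≠ b) :
    IsLift Γ (Equiv.swap a b) (Γ (rootVec a b)) := by
  refine ⟨fun f hf => ?_, ?_⟩
  · have h1 := h.rel (rootVec a b) f (sum_rootVec a b) hf
    rw [sum_mul_rootVec] at h1
    rw [csign_swap hab, comp_swap_eq, h.add, h.smul, add_mul, smul_mul_assoc, h.root_sq hab,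
      eq_sub_of_add_eq h1]
    push_cast
    module
  · rw [h.adjoint _ (sum_rootVec a b), neg_mul, h.root_sq hab, neg_neg]

theorem exists_smul_one [Nontrivial V] (h : SpinFrame Γ) (hX : IsLift Γ 1 X) :
    ∃ c : ℂ, ‖c‖ = 1 ∧ X = c • 1 := by
  obtain ⟨c, rfl⟩ := h.scalar X (fun f hf => by
    have := hX.comm f hf
    simpa [csign_one] using this)
  refine ⟨c, ?_, rfl⟩
  have h1 := hX.unit
  have h2 : LinearMap.adjoint (1 : End ℂ V) = 1 := LinearMap.adjoint_id
  rw [map_smulₛₗ, smul_mul_smul_comm, h2, one_mul, ← Complex.normSq_eq_conj_mul_self] at h1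
  obtain ⟨v, hv⟩ := exists_ne (0 : V)
  have h3 : (Complex.normSq c : ℂ) • v = (1 : ℂ) • v := by
    rw [one_smul]; exact LinearMap.congr_fun h1 v
  have h4 : Complex.normSq c = 1 := by exact_mod_cast smul_left_injective ℂ hv h3
  rw [Complex.normSq_eq_norm_sq] at h4
  nlinarith [norm_nonneg c]

theorem unique [Nontrivial V] (h : SpinFrame Γ) (hX : IsLift Γ ψ X) (hY : IsLift Γ ψ Y) :
    ∃ c : ℂ, ‖c‖ = 1 ∧ X = c • Y := by
  have h1 := hX.mul hY.adjoint
  rw [mul_inv_cancel] at h1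
  obtain ⟨c, hc, h2⟩ := h1.exists_smul_one h
  refine ⟨c, hc, ?_⟩
  calc X = X * LinearMap.adjoint Y * Y := by rw [mul_assoc, hY.unit, mul_one]
    _ = _ := by rw [h2, smul_mul_assoc, one_mul]

theorem exists_lift (h : SpinFrame Γ) (ψ : Equiv.Perm ι) : ∃ X, IsLift Γ ψ X := by
  induction ψ using Equiv.Perm.swap_induction_on with
  | one => exact ⟨1, one⟩
  | swap_mul ψ a b hab ih =>
    obtain ⟨X, hX⟩ := ih
    exact ⟨_, (root h hab).mul hX⟩

end IsLift

/-- Operators commuting, up to the scalar `ε`, with the frame vectors constant on `S`. -/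
def parity (Γ : (ι → ℝ) → End ℂ V) (S : Finset ι) (ε : ℂ) : Submodule ℂ (End ℂ V) where
  carrier := {a | ∀ f, ∑ i, f i = 0 → (∀ i ∈ S, ∀ j ∈ S, f i = f j) → a * Γ f = ε • (Γ f * a)}
  zero_mem' := fun f _ _ => by simp
  add_mem' := fun {a b} ha hb f hf hS => by
    rw [add_mul, ha f hf hS, hb f hf hS, mul_add, smul_add]
  smul_mem' := fun c a ha f hf hS => by
    rw [smul_mul_assoc, ha f hf hS, mul_smul_comm, smul_comm]

/-- The operators supported on `S`. -/
def localAlg (Γ : (ι → ℝ) → End ℂ V) (S : Finset ι) : Submodule ℂ (End ℂ V) :=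
  parity Γ S 1 ⊔ parity Γ S (-1)

theorem parity_mul {S : Finset ι} {ε δ : ℂ} {a b : End ℂ V} (ha : a ∈ parity Γ S ε)
    (hb : b ∈ parity Γ S δ) : a * b ∈ parity Γ S (ε * δ) := fun f hf hS => by
  rw [mul_assoc, hb f hf hS, mul_smul_comm, ← mul_assoc, ha f hf hS, smul_mul_assoc, smul_smul,
    mul_comm δ, mul_assoc]

theorem parity_adjoint (h : SpinFrame Γ) {S : Finset ι} {ε : ℂ} (hε : ε = 1 ∨ ε = -1)
    {a : End ℂ V} (ha : a ∈ parity Γ S ε) : LinearMap.adjoint a ∈ parity Γ S ε := fun f hf hS => by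
  have h1 := congrArg LinearMap.adjoint (ha f hf hS)
  have hm : ∀ x y : End ℂ V, LinearMap.adjoint (x * y) = LinearMap.adjoint y * LinearMap.adjoint x :=
    LinearMap.adjoint_comp
  rw [map_smulₛₗ, hm, hm, h.adjoint f hf] at h1
  have h2 : Γ f * LinearMap.adjoint a = (starRingEnd ℂ) ε • (LinearMap.adjoint a * Γ f) := by
    rw [← neg_inj, ← neg_mul, h1, mul_neg, smul_neg]
  rw [h2, smul_smul]
  rcases hε with rfl | rfl <;> simp

theorem one_mem_parity (S : Finset ι) : (1 : End ℂ V) ∈ parity Γ S 1 := fun f _ _ => by simp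

theorem IsLift.mem_parity (hX : IsLift Γ ψ X) {S : Finset ι} (hS : ψ.support ⊆ S) :
    X ∈ parity Γ S (csign ψ) := fun f hf hc => by
  rw [hX.comm f hf]
  congr 3
  ext i
  by_cases hi : ψ i = i
  · rw [Function.comp, Equiv.Perm.inv_eq_iff_eq.2 hi.symm]
  · have h1 : i ∈ ψ.support := Equiv.Perm.mem_support.2 hi
    refine hc _ (hS ?_) _ (hS h1)
    rw [← Equiv.Perm.support_inv] at h1 ⊢
    exact Equiv.Perm.apply_mem_support.2 h1

theorem parity_le_localAlg {S : Finset ι} {ε : ℂ} (hε : ε = 1 ∨ ε = -1) :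
    parity Γ S ε ≤ localAlg Γ S := by
  rcases hε with rfl | rfl
  · exact le_sup_left
  · exact le_sup_right

theorem IsLift.mem_localAlg (hX : IsLift Γ ψ X) {S : Finset ι} (hS : ψ.support ⊆ S) :
    X ∈ localAlg Γ S := parity_le_localAlg (csign_eq ψ) (hX.mem_parity hS)

theorem localAlg_mul {S : Finset ι} {a b : End ℂ V} (ha : a ∈ localAlg Γ S)
    (hb : b ∈ localAlg Γ S) : a * b ∈ localAlg Γ S := by
  obtain ⟨a1, h1, a2, h2, rfl⟩ := Submodule.mem_sup.1 ha
  obtain ⟨b1, k1, b2, k2, rfl⟩ := Submodule.mem_sup.1 hb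
  rw [add_mul, mul_add, mul_add]
  exact add_mem (add_mem (parity_le_localAlg (by simp) (parity_mul h1 k1))
    (parity_le_localAlg (by simp) (parity_mul h1 k2)))
    (add_mem (parity_le_localAlg (by simp) (parity_mul h2 k1))
    (parity_le_localAlg (by simp) (parity_mul h2 k2)))

theorem localAlg_adjoint (h : SpinFrame Γ) {S : Finset ι} {a : End ℂ V} (ha : a ∈ localAlg Γ S) :
    LinearMap.adjoint a ∈ localAlg Γ S := by
  obtain ⟨a1, h1, a2, h2, rfl⟩ := Submodule.mem_sup.1 ha
  rw [map_add]
  exact add_mem (parity_le_localAlg (by simp) (parity_adjoint h (by simp) h1))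
    (parity_le_localAlg (by simp) (parity_adjoint h (by simp) h2))

end Frame

/-! ### Traces of products with lifts -/

section Trace

set_option linter.unusedSectionVars false

variable {V : Type*} [NormedAddCommGroup V] [InnerProductSpace ℂ V] [FiniteDimensional ℂ V]
  [Nontrivial V] {ι : Type*} [Fintype ι] [DecidableEq ι]
  {Γ : (ι → ℝ) → End ℂ V} {ψ χ : Equiv.Perm ι} {X Y : End ℂ V}

local notation "tr" => LinearMap.trace ℂ V

theorem trace_eq_zero_of_anti {a x : End ℂ V} {c : ℂ} (hc : c ≠ 0) (hx : x * x = c • 1)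
    (h : a * x = -(x * a)) : tr a = 0 := by
  have h1 : tr (a * x * x) = c * tr a := by
    rw [mul_assoc, hx, mul_smul_comm, mul_one, map_smul, smul_eq_mul]
  have h2 : tr (a * x * x) = -tr (a * x * x) := by
    conv_lhs => rw [h, neg_mul, map_neg, mul_assoc, LinearMap.trace_mul_comm]
  have h3 : tr (a * x * x) = 0 := by linear_combination h2 / 2
  rw [h1] at h3
  exact (mul_eq_zero.1 h3).resolve_left hc

theorem exists_two_valued {C : Finset ι} (hC : C.Nonempty) (hC' : C ≠ Finset.univ) :
    ∃ f : ι → ℝ, ∑ i, f i = 0 ∧ ∑ i, f i * f i ≠ 0 ∧ ∀ i j, (i ∈ C ↔ j ∈ C) → f i = f j := by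
  have hCc : Cᶜ.Nonempty := by
    rw [Finset.nonempty_iff_ne_empty]
    simpa using hC'
  refine ⟨fun i => if i ∈ C then (Cᶜ.card : ℝ) else -C.card, ?_, ?_, ?_⟩
  · rw [Finset.sum_ite]
    simp only [Finset.sum_const, nsmul_eq_mul]
    have h1 : (Finset.univ.filter fun i => i ∈ C) = C := by ext; simp
    have h2 : (Finset.univ.filter fun i => i ∉ C) = Cᶜ := by ext; simp
    rw [h1, h2]; ring
  · obtain ⟨i, hi⟩ := hC
    refine (Finset.sum_pos' (fun j _ => mul_self_nonneg _) ⟨i, Finset.mem_univ _, ?_⟩).ne'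
    have := hCc.card_pos
    simp only [hi, if_true]
    positivity
  · intro i j hij
    simp only [hij]

theorem trace_parity_eq_zero (h : SpinFrame Γ) {C : Finset ι} (hC : C.Nonempty)
    (hC' : C ≠ Finset.univ) {a : End ℂ V}
    (ha : ∀ f, ∑ i, f i = 0 → (∀ i j, (i ∈ C ↔ j ∈ C) → f i = f j) → a * Γ f = -(Γ f * a)) :
    tr a = 0 := by
  obtain ⟨f, hf, hne, hc⟩ := exists_two_valued hC hC'
  refine trace_eq_zero_of_anti ?_ (h.sq hf) (ha f hf hc)
  rw [div_ne_zero_iff]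
  exact ⟨neg_ne_zero.2 (by exact_mod_cast hne), two_ne_zero⟩

theorem comp_inv_eq_of_support {C : Finset ι} (hC : χ.support ⊆ C) {f : ι → ℝ}
    (hf : ∀ i ∈ C, ∀ j ∈ C, f i = f j) : f ∘ ⇑χ⁻¹ = f := by
  ext i
  by_cases hi : χ i = i
  · rw [Function.comp, Equiv.Perm.inv_eq_iff_eq.2 hi.symm]
  · have h1 : i ∈ χ.support := Equiv.Perm.mem_support.2 hi
    refine hf _ (hC ?_) _ (hC h1)
    rw [← Equiv.Perm.support_inv] at h1 ⊢
    exact Equiv.Perm.apply_mem_support.2 h1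

theorem trace_mul_eq_zero (h : SpinFrame Γ) {C S : Finset ι} (hC : C.Nonempty)
    (hC' : C ≠ Finset.univ) (hS : Disjoint S C) {ε : ℂ} {a : End ℂ V} (ha : a ∈ parity Γ S ε)
    (hX : IsLift Γ χ X) (hχ : χ.support ⊆ C) (hε : ε * csign χ = -1) : tr (a * X) = 0 := by
  refine trace_parity_eq_zero h hC hC' fun f hf hc => ?_
  have hS' : ∀ i ∈ S, ∀ j ∈ S, f i = f j := fun i hi j hj => hc i j
    ⟨fun h => absurd h (Finset.disjoint_left.1 hS hi), fun h => absurd h (Finset.disjoint_left.1 hS hj)⟩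
  have hCf : f ∘ ⇑χ⁻¹ = f :=
    comp_inv_eq_of_support hχ fun i hi j hj => hc i j ⟨fun _ => hj, fun _ => hi⟩
  rw [mul_assoc, hX.comm f hf, hCf, mul_smul_comm, ← mul_assoc, ha f hf hS', smul_mul_assoc,
    smul_smul, mul_comm, hε, neg_smul, one_smul, mul_assoc]

theorem IsLift.exists_trace_parity (h : SpinFrame Γ) (S : Finset ι) (N : ℕ) :
    ∀ (ψ : Equiv.Perm ι) (X : End ℂ V), IsLift Γ ψ X → ψ.support.card = N →
      Disjoint S ψ.support → ψ.support ≠ Finset.univ →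
      ∃ θ : ℂ, ‖θ‖ ≤ (1 / 2) ^ ((N + 2) / 3) ∧
        ∀ ε : ℂ, ε = 1 ∨ ε = -1 → ∀ a ∈ parity Γ S ε, tr (a * X) = θ * tr a := by
  induction N using Nat.strong_induction_on with
  | _ N ih =>
  intro ψ X hX hN hS huniv
  by_cases hψ : ψ = 1
  · subst hψ
    obtain ⟨c, hc, rfl⟩ := hX.exists_smul_one h
    refine ⟨c, ?_, fun ε _ a _ => by rw [mul_smul_comm, mul_one, map_smul, smul_eq_mul]⟩
    rw [hc, ← hN]; simp
  obtain ⟨a, ha⟩ : ∃ a, ψ a ≠ a := by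
    by_contra hcon
    push Not at hcon
    exact hψ (Equiv.ext hcon)
  set b := ψ a with hb
  set c := ψ b with hc
  have hcb : c ≠ b := fun hcb => ha (ψ.injective hcb)
  have hτ := IsLift.root h ha.symm
  set τ := Γ (rootVec a b) with hτd
  have hττ : τ * τ = -1 := h.root_sq ha.symm
  set X' := (-1 : ℂ) • (τ * X) with hX'd
  have hX' : IsLift Γ (Equiv.swap a b * ψ) X' := (hτ.mul hX).smul (by simp)
  have hXX' : X = τ * X' := by
    rw [hX'd, mul_smul_comm, ← mul_assoc, hττ]; simp
  set ψ1 := Equiv.swap a b * ψ with hψ1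
  have hψ1a : ψ1 a = a := by
    rw [hψ1, Equiv.Perm.mul_apply, ← hb, Equiv.swap_apply_right]
  have hs1 : csign ψ1 = -csign ψ := by rw [hψ1, csign_mul, csign_swap ha.symm, neg_one_mul]
  have haS : a ∉ S := fun h => Finset.disjoint_left.1 hS h (Equiv.Perm.mem_support.2 ha)
  have hbS : b ∉ S := fun h => Finset.disjoint_left.1 hS h (Equiv.Perm.mem_support.2 hcb)
  have hroot : ∀ i ∈ S, ∀ j ∈ S, rootVec a b i = rootVec a b j := by
    intro i hi j hj
    have : ∀ i ∈ S, rootVec a b i = 0 := by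
      intro i hi
      have h1 : i ≠ a := fun h => haS (h ▸ hi)
      have h2 : i ≠ b := fun h => hbS (h ▸ hi)
      simp [rootVec, h1, h2]
    rw [this i hi, this j hj]
  have hCne : ψ.support.Nonempty := ⟨a, Equiv.Perm.mem_support.2 ha⟩
  have hmis : ∀ {χ Y}, IsLift Γ χ Y → χ.support ⊆ ψ.support → csign χ = csign ψ → ∀ ε : ℂ,
      ε ≠ csign ψ → ε = 1 ∨ ε = -1 → ∀ α ∈ parity Γ S ε, tr (α * Y) = 0 := by
    intro χ Y hY hsup hsgn ε hne hε α hα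
    refine trace_mul_eq_zero h hCne huniv hS hα hY hsup ?_
    rw [hsgn]
    rcases hε with rfl | rfl <;> rcases csign_eq ψ with h1 | h1 <;> rw [h1] at hne ⊢ <;>
      first | exact absurd rfl hne | norm_num
  have hswap : ∀ α ∈ parity Γ S (csign ψ), tr (α * X) = -tr (α * Γ (rootVec a (ψ1 b)) * X') := by
    intro α hα
    have h1 : X' * τ = csign ψ1 • (Γ (rootVec a (ψ1 b)) * X') := by
      rw [hτd, hX'.comm _ (sum_rootVec a b), rootVec_comp, hψ1a]
    calc tr (α * X) = tr (α * τ * X') := by rw [hXX', mul_assoc]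
      _ = csign ψ * tr (τ * α * X') := by
        rw [hα _ (sum_rootVec a b) hroot, smul_mul_assoc, map_smul, smul_eq_mul]
      _ = csign ψ * tr (α * (X' * τ)) := by
        rw [mul_assoc, LinearMap.trace_mul_comm, mul_assoc]
      _ = (csign ψ * csign ψ1) * tr (α * Γ (rootVec a (ψ1 b)) * X') := by
        rw [h1, mul_smul_comm, map_smul, smul_eq_mul, mul_assoc, mul_assoc]
      _ = _ := by rw [hs1, mul_neg, csign_mul_self, neg_one_mul]
  by_cases hca : c = a
  · refine ⟨0, by simp, fun ε hε α hα => ?_⟩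
    rw [zero_mul]
    by_cases hne : ε = csign ψ
    · subst hne
      have h1 := hswap α hα
      have h2 : ψ1 b = b := by
        rw [hψ1, Equiv.Perm.mul_apply, ← hc, hca, Equiv.swap_apply_left]
      rw [h2, mul_assoc, ← hτd, ← hXX'] at h1
      linear_combination h1 / 2
    · exact hmis hX (Finset.Subset.refl _) rfl ε hne hε α hα
  have hψ1b : ψ1 b = c := by
    rw [hψ1, Equiv.Perm.mul_apply, ← hc, Equiv.swap_apply_of_ne_of_ne hca hcb]
  set W := Γ (rootVec c b) * X' with hW
  have hWl : IsLift Γ (Equiv.swap c b * ψ1) W := (IsLift.root h hcb).mul hX'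
  set ψ2 := Equiv.swap c b * ψ1 with hψ2
  have hs2 : csign ψ2 = csign ψ := by rw [hψ2, csign_mul, csign_swap hcb, hs1]; ring
  have h2a : ψ2 a = a := by
    rw [hψ2, Equiv.Perm.mul_apply, hψ1a,
      Equiv.swap_apply_of_ne_of_ne (fun h => hca h.symm) ha.symm]
  have h2b : ψ2 b = b := by
    rw [hψ2, Equiv.Perm.mul_apply, hψ1b, Equiv.swap_apply_left]
  have hfix : ∀ i, ψ i = i → ψ2 i = i := by
    intro i hi
    have i1 : i ≠ a := fun h => ha (by rw [h] at hi; exact hi)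
    have i2 : i ≠ b := fun h => hcb (by rw [h] at hi; exact hi)
    have i3 : i ≠ c := by
      intro h
      have : ψ i = ψ b := by rw [hi, h, hc]
      exact i2 (ψ.injective this)
    rw [hψ2, hψ1, Equiv.Perm.mul_apply, Equiv.Perm.mul_apply, hi,
      Equiv.swap_apply_of_ne_of_ne i1 i2, Equiv.swap_apply_of_ne_of_ne i3 i2]
  have hsub : ψ2.support ⊆ ψ.support := by
    intro i hi
    rw [Equiv.Perm.mem_support] at hi ⊢
    exact fun h => hi (hfix i h)
  have hlt : ψ2.support.card < N := by
    rw [← hN]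
    refine Finset.card_lt_card (Finset.ssubset_iff_subset_ne.2 ⟨hsub, fun h => ?_⟩)
    have : a ∈ ψ2.support := h ▸ Equiv.Perm.mem_support.2 ha
    exact Equiv.Perm.mem_support.1 this h2a
  have hge : N ≤ ψ2.support.card + 3 := by
    have : ψ.support ⊆ ψ2.support ∪ {a, b, c} := by
      intro i hi
      by_contra hcon
      simp only [Finset.mem_union, Finset.mem_insert, Finset.mem_singleton, not_or,
        Equiv.Perm.mem_support, not_not] at hcon
      obtain ⟨k1, k2, k3, k4⟩ := hcon
      apply Equiv.Perm.mem_support.1 hi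
      have : ψ i = Equiv.swap a b (Equiv.swap c b (ψ2 i)) := by
        simp [hψ2, hψ1]
      rw [this, k1, Equiv.swap_apply_of_ne_of_ne k4 k3, Equiv.swap_apply_of_ne_of_ne k2 k3]
    calc N = ψ.support.card := hN.symm
      _ ≤ (ψ2.support ∪ {a, b, c}).card := Finset.card_le_card this
      _ ≤ ψ2.support.card + ({a, b, c} : Finset ι).card := Finset.card_union_le _ _
      _ ≤ _ := by gcongr; exact Finset.card_le_three
  obtain ⟨θ, hθ, hθ'⟩ := ih _ hlt ψ2 W hWl rfl (Finset.disjoint_of_subset_right hsub hS)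
    (fun h => huniv (Finset.univ_subset_iff.1 (h ▸ hsub)))
  refine ⟨θ / 2, ?_, fun ε hε α hα => ?_⟩
  · rw [norm_div, Complex.norm_ofNat]
    calc ‖θ‖ / 2 ≤ (1 / 2) ^ ((ψ2.support.card + 2) / 3) / 2 := by gcongr
      _ = (1 / 2) ^ ((ψ2.support.card + 2) / 3 + 1) := by rw [pow_succ]; ring
      _ ≤ _ := pow_le_pow_of_le_one (by norm_num) (by norm_num) (by omega)
  · have h2 : tr (α * X) = tr (α * W) / 2 := by
      by_cases hne : ε = csign ψ
      · subst hne
        have h1 := hswap α hα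
        rw [hψ1b] at h1
        have h3 : α * W = α * X - α * Γ (rootVec a c) * X' := by
          rw [hW, ← rootVec_sub a b c, h.add, h.smul, hXX']
          push_cast
          rw [neg_one_smul, add_mul, mul_add, neg_mul, mul_neg, ← sub_eq_add_neg, mul_assoc]
        rw [h3, map_sub]
        linear_combination h1 / 2
      · rw [hmis hX (Finset.Subset.refl _) rfl ε hne hε α hα, hmis hWl hsub hs2 ε hne hε α hα,
          zero_div]
    rw [h2, hθ' ε hε α hα]
    ring

theorem IsLift.exists_trace (h : SpinFrame Γ) {S : Finset ι} (hX : IsLift Γ ψ X)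
    (hS : Disjoint S ψ.support) (huniv : ψ.support ≠ Finset.univ) :
    ∃ θ : ℂ, ‖θ‖ ≤ (1 / 2) ^ ((ψ.support.card + 2) / 3) ∧
      ∀ a ∈ localAlg Γ S, tr (a * X) = θ * tr a := by
  obtain ⟨θ, h1, h2⟩ := IsLift.exists_trace_parity h S _ ψ X hX rfl hS huniv
  refine ⟨θ, h1, fun a ha => ?_⟩
  obtain ⟨b, hb, c, hc, rfl⟩ := Submodule.mem_sup.1 ha
  rw [add_mul, map_add, map_add, h2 1 (by simp) b hb, h2 (-1) (by simp) c hc, mul_add]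

theorem trace_one_ne_zero : tr 1 ≠ 0 := by
  rw [LinearMap.trace_one]
  exact_mod_cast (finrank_pos (R := ℂ) (M := V)).ne'

theorem inner_self_eq_ofReal (w : V) : inner ℂ w w = ((‖w‖ ^ 2 : ℝ) : ℂ) := by
  rw [inner_self_eq_norm_sq_to_K, Complex.ofReal_pow]; rfl

theorem eq_zero_of_trace_adjoint_mul {x : End ℂ V} (hx : tr (LinearMap.adjoint x * x) = 0) :
    x = 0 := by
  rw [LinearMap.trace_eq_sum_inner _ (stdOrthonormalBasis ℂ V)] at hx
  simp only [Module.End.mul_apply, LinearMap.adjoint_inner_right, inner_self_eq_ofReal] at hx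
  rw [← Complex.ofReal_sum, Complex.ofReal_eq_zero] at hx
  rw [Finset.sum_eq_zero_iff_of_nonneg (fun i _ => by positivity)] at hx
  refine (stdOrthonormalBasis ℂ V).toBasis.ext fun i => ?_
  have := hx i (Finset.mem_univ i)
  simpa using this

/-- Linear disjointness of operators supported on disjoint sets. -/
theorem eq_zero_of_sum_mul_lift_eq_zero (h : SpinFrame Γ) {S T : Finset ι} (hST : Disjoint S T)
    (hT : T ≠ Finset.univ) {J : Type*} [Fintype J] {β : J → Equiv.Perm ι} {b x : J → End ℂ V}
    (hb : ∀ j, IsLift Γ (β j) (b j)) (hβ : ∀ j, (β j).support ⊆ T)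
    (hli : LinearIndependent ℂ b) (hx : ∀ j, x j ∈ localAlg Γ S) (h0 : ∑ j, x j * b j = 0)
    (j : J) : x j = 0 := by
  have key : ∀ a ∈ localAlg Γ S, ∀ j, tr (a * x j) = 0 := by
    intro a ha
    have hgram : ∀ i, tr ((∑ j, tr (a * x j) • b j) * LinearMap.adjoint (b i)) = 0 := by
      intro i
      have h1 : ∀ j, tr 1 * tr (a * x j * (b j * LinearMap.adjoint (b i))) =
          tr (a * x j) * tr (b j * LinearMap.adjoint (b i)) := by
        intro j
        have hsup : (β j * (β i)⁻¹).support ⊆ T :=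
          (Equiv.Perm.support_mul_le _ _).trans
            (sup_le (hβ j) (by rw [Equiv.Perm.support_inv]; exact hβ i))
        obtain ⟨θ, -, hθ⟩ := ((hb j).mul (hb i).adjoint).exists_trace h (S := S)
          (Finset.disjoint_of_subset_right hsup hST)
          (fun h => hT (Finset.univ_subset_iff.1 (h ▸ hsup)))
        have h2 := hθ 1 (parity_le_localAlg (by simp) (one_mem_parity S))
        rw [one_mul] at h2
        rw [hθ _ (localAlg_mul ha (hx j)), h2]
        ring
      rw [Finset.sum_mul, map_sum]
      have h2 : tr (a * (∑ j, x j * b j) * LinearMap.adjoint (b i)) = 0 := by rw [h0]; simp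
      rw [Finset.mul_sum, Finset.sum_mul, map_sum] at h2
      calc _ = ∑ j, tr 1 * tr (a * (x j * b j) * LinearMap.adjoint (b i)) := by
            refine Finset.sum_congr rfl fun j _ => ?_
            rw [smul_mul_assoc, map_smul, smul_eq_mul, ← h1 j]
            simp only [mul_assoc]
        _ = 0 := by rw [← Finset.mul_sum, h2, mul_zero]
    set B := ∑ j, tr (a * x j) • b j with hB
    have hBB : tr (LinearMap.adjoint B * B) = 0 := by
      rw [LinearMap.trace_mul_comm]
      conv_lhs => enter [2, 2]; rw [hB]
      rw [map_sum, Finset.mul_sum, map_sum]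
      refine Finset.sum_eq_zero fun i _ => ?_
      rw [map_smulₛₗ, mul_smul_comm, map_smul, hgram i, smul_zero]
    have hB0 := eq_zero_of_trace_adjoint_mul hBB
    exact Fintype.linearIndependent_iff.1 hli _ (hB ▸ hB0)
  exact eq_zero_of_trace_adjoint_mul (key _ (localAlg_adjoint h (hx j)) j)

/-- Lifts of permutations whose quotients move many points are linearly independent. -/
theorem linearIndependent_of_card_support (h : SpinFrame Γ) {J : Type*} [Fintype J]
    [DecidableEq J] {β : J → Equiv.Perm ι} {b : J → End ℂ V} (hb : ∀ j, IsLift Γ (β j) (b j))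
    {N : ℕ} (hN : ∀ i j, i ≠ j → N ≤ (β i * (β j)⁻¹).support.card)
    (huniv : ∀ i j, (β i * (β j)⁻¹).support ≠ Finset.univ)
    (hJ : Fintype.card J - 1 < 2 ^ ((N + 2) / 3)) : LinearIndependent ℂ b := by
  rw [Fintype.linearIndependent_iff]
  intro c hc
  by_contra hcon
  push Not at hcon
  obtain ⟨i0, hi0⟩ := hcon
  obtain ⟨i, -, hi⟩ := Finset.exists_max_image Finset.univ (fun j => ‖c j‖) ⟨i0, Finset.mem_univ _⟩
  have hpos : 0 < ‖c i‖ := (norm_pos_iff.2 hi0).trans_le (hi i0 (Finset.mem_univ _))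
  have hθ : ∀ j, ∃ θ : ℂ, ‖θ‖ ≤ (1 / 2) ^ (((β j * (β i)⁻¹).support.card + 2) / 3) ∧
      tr (b j * LinearMap.adjoint (b i)) = θ * tr 1 := by
    intro j
    obtain ⟨θ, h1, h2⟩ := ((hb j).mul (hb i).adjoint).exists_trace h (S := ∅) (by simp) (huniv j i)
    refine ⟨θ, h1, ?_⟩
    have := h2 1 (parity_le_localAlg (by simp) (one_mem_parity ∅))
    rwa [one_mul] at this
  choose θ hθ1 hθ2 using hθ
  have h1 : tr ((∑ j, c j • b j) * LinearMap.adjoint (b i)) = 0 := by rw [hc]; simp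
  rw [Finset.sum_mul, map_sum, ← Finset.add_sum_erase _ _ (Finset.mem_univ i), smul_mul_assoc,
    map_smul, (hb i).unit', smul_eq_mul] at h1
  have h2 : c i + ∑ j ∈ Finset.univ.erase i, c j * θ j = 0 := by
    have : (c i + ∑ j ∈ Finset.univ.erase i, c j * θ j) * tr 1 = 0 := by
      rw [← h1, add_mul, Finset.sum_mul]
      congr 1
      refine Finset.sum_congr rfl fun j _ => ?_
      rw [smul_mul_assoc, map_smul, hθ2 j, smul_eq_mul, mul_assoc]
    exact (mul_eq_zero.1 this).resolve_right trace_one_ne_zero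
  have h3 : ‖c i‖ ≤ (Fintype.card J - 1 : ℕ) * (‖c i‖ * (1 / 2) ^ ((N + 2) / 3)) := by
    calc ‖c i‖ = ‖∑ j ∈ Finset.univ.erase i, c j * θ j‖ := by
          conv_lhs => rw [eq_neg_of_add_eq_zero_left h2, norm_neg]
      _ ≤ ∑ j ∈ Finset.univ.erase i, ‖c i‖ * (1 / 2) ^ ((N + 2) / 3) := by
        refine norm_sum_le_of_le _ fun j hj => ?_
        rw [norm_mul]
        refine mul_le_mul (hi j (Finset.mem_univ j)) ((hθ1 j).trans ?_) (norm_nonneg _)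
          (norm_nonneg _)
        refine pow_le_pow_of_le_one (by norm_num) (by norm_num) ?_
        have := hN j i (Finset.ne_of_mem_erase hj)
        omega
      _ = _ := by
        rw [Finset.sum_const, nsmul_eq_mul, Finset.card_erase_of_mem (Finset.mem_univ i),
          Finset.card_univ]
  have h4 : ((Fintype.card J - 1 : ℕ) : ℝ) < 2 ^ ((N + 2) / 3) := by exact_mod_cast hJ
  have h5 : ((Fintype.card J - 1 : ℕ) : ℝ) * (‖c i‖ * (1 / 2) ^ ((N + 2) / 3)) < ‖c i‖ := by
    calc _ < (2 : ℝ) ^ ((N + 2) / 3) * (‖c i‖ * (1 / 2) ^ ((N + 2) / 3)) := by gcongr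
      _ = ‖c i‖ * ((2 : ℝ) ^ ((N + 2) / 3) * (1 / 2) ^ ((N + 2) / 3)) := by ring
      _ = ‖c i‖ := by rw [← mul_pow]; norm_num
  linarith

end Trace

/-! ### Independence of powers of lifts -/

theorem LinearIndepOn.of_eq_smul {K M κ : Type*} [Field K] [AddCommGroup M] [Module K M]
    {f g : κ → M} {s : Finset κ} (hf : LinearIndepOn K f s) {c : κ → K} (hc : ∀ i ∈ s, c i ≠ 0)
    (h : ∀ i ∈ s, g i = c i • f i) : LinearIndepOn K g s := by
  rw [linearIndepOn_finset_iff] at hf ⊢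
  intro d hd i hi
  have := hf (fun i => d i * c i) (by
    rw [← hd]
    exact Finset.sum_congr rfl fun i hi => by rw [h i hi, smul_smul]) i hi
  exact (mul_eq_zero.1 this).resolve_right (hc i hi)

section Powers

set_option linter.unusedSectionVars false

variable {V : Type*} [NormedAddCommGroup V] [InnerProductSpace ℂ V] [FiniteDimensional ℂ V]
  [Nontrivial V] {ι : Type*} [Fintype ι] [DecidableEq ι]
  {Γ : (ι → ℝ) → End ℂ V} {ψ χ : Equiv.Perm ι} {X Y : End ℂ V}

/-- The powers of any lift of `ψ` below the order of `ψ` are linearly independent. -/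
def FullPowers (Γ : (ι → ℝ) → End ℂ V) (ψ : Equiv.Perm ι) : Prop :=
  ∀ X, IsLift Γ ψ X → LinearIndepOn ℂ (fun j : ℕ => X ^ j) (Finset.range (orderOf ψ) : Set ℕ)

theorem IsLift.ne_zero (hX : IsLift Γ ψ X) : X ≠ 0 := by
  rintro rfl
  have := hX.unit
  rw [mul_zero] at this
  exact zero_ne_one this

theorem IsLift.pow_linearIndepOn (h : SpinFrame Γ) (hX : IsLift Γ ψ X)
    (huniv : ψ.support ≠ Finset.univ) {s : Finset ℕ} {N : ℕ}
    (hN : ∀ i ∈ s, ∀ j ∈ s, i < j → N ≤ (ψ ^ (j - i)).support.card)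
    (hs : s.card - 1 < 2 ^ ((N + 2) / 3)) : LinearIndepOn ℂ (fun j : ℕ => X ^ j) (s : Set ℕ) := by
  refine linearIndependent_of_card_support h (J := s) (β := fun j => ψ ^ (j : ℕ))
    (fun j => hX.pow j) (N := N) ?_ ?_ (by simpa using hs)
  · have hlt : ∀ {i j : ℕ}, i < j → ψ ^ j * (ψ ^ i)⁻¹ = ψ ^ (j - i) := by
      intro i j hij
      rw [mul_inv_eq_iff_eq_mul, ← pow_add, Nat.sub_add_cancel hij.le]
    intro i j hij
    rcases lt_or_gt_of_ne (fun h => hij (Subtype.ext h) : (i : ℕ) ≠ j) with h1 | h1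
    · rw [← Equiv.Perm.support_inv, mul_inv_rev, inv_inv, hlt h1]
      exact hN i i.2 j j.2 h1
    · rw [hlt h1]
      exact hN j j.2 i i.2 h1
  · intro i j hcon
    apply huniv
    rw [← Finset.univ_subset_iff, ← hcon]
    refine (Equiv.Perm.support_mul_le _ _).trans (sup_le (Equiv.Perm.support_pow_le _ _) ?_)
    rw [Equiv.Perm.support_inv]
    exact Equiv.Perm.support_pow_le _ _

theorem fullPowers_of_card_support (h : SpinFrame Γ) (huniv : ψ.support ≠ Finset.univ) {N : ℕ}
    (hN : ∀ j, 0 < j → j < orderOf ψ → N ≤ (ψ ^ j).support.card)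
    (hs : orderOf ψ - 1 < 2 ^ ((N + 2) / 3)) : FullPowers Γ ψ := fun X hX =>
  hX.pow_linearIndepOn h huniv (N := N) (fun i _ j hj hij => hN _ (by omega) (by
    have := Finset.mem_range.1 hj; omega)) (by simpa using hs)

theorem IsLift.mul_pow_linearIndepOn (h : SpinFrame Γ) (hd : ψ.Disjoint χ)
    (huniv : ψ.support ≠ Finset.univ) (hψ : FullPowers Γ ψ) (hY : IsLift Γ χ Y) {J : Finset ℕ}
    (hJ : ∀ r, LinearIndepOn ℂ (fun j : ℕ => Y ^ j)
      (J.filter (fun j => j % orderOf ψ = r) : Set ℕ))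
    {Z : End ℂ V} (hZ : IsLift Γ (ψ * χ) Z) : LinearIndepOn ℂ (fun j : ℕ => Z ^ j) (J : Set ℕ) := by
  obtain ⟨X, hX⟩ := IsLift.exists_lift h ψ
  have hm : 0 < orderOf ψ := orderOf_pos ψ
  have hZj : ∀ j, ∃ c : ℂ, c ≠ 0 ∧ Z ^ j = c • (Y ^ j * X ^ (j % orderOf ψ)) := by
    intro j
    have h1 := (hY.pow j).mul (hX.pow (j % orderOf ψ))
    rw [pow_mod_orderOf, ← hd.commute.symm.mul_pow, ← hd.commute.eq] at h1
    obtain ⟨c, hc, h2⟩ := (hZ.pow j).unique h h1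
    exact ⟨c, norm_ne_zero_iff.1 (by rw [hc]; exact one_ne_zero), h2⟩
  choose c hc hZc using hZj
  suffices h1 : LinearIndepOn ℂ (fun j : ℕ => Y ^ j * X ^ (j % orderOf ψ)) (J : Set ℕ) from
    h1.of_eq_smul (fun i _ => hc i) (fun i _ => hZc i)
  rw [linearIndepOn_finset_iff]
  intro d hd0
  let q : ℕ → Fin (orderOf ψ) := fun j => ⟨j % orderOf ψ, Nat.mod_lt _ hm⟩
  have hli : LinearIndependent ℂ (fun ρ : Fin (orderOf ψ) => X ^ (ρ : ℕ)) :=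
    (hψ X hX).linearIndependent.comp
      (fun ρ : Fin (orderOf ψ) => (⟨ρ, by simp⟩ : (Finset.range (orderOf ψ) : Set ℕ)))
      (fun a b hab => Fin.ext (congrArg Subtype.val hab))
  have hmem : ∀ j, Y ^ j ∈ localAlg Γ χ.support := fun j =>
    (hY.pow j).mem_localAlg (Equiv.Perm.support_pow_le _ _)
  have hzero := eq_zero_of_sum_mul_lift_eq_zero h
    (Equiv.Perm.disjoint_iff_disjoint_support.1 hd.symm) huniv (fun ρ => hX.pow (ρ : ℕ))
    (fun ρ => Equiv.Perm.support_pow_le _ _) hli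
    (x := fun ρ => ∑ j ∈ J with q j = ρ, d j • Y ^ j)
    (fun ρ => Submodule.sum_mem _ fun j _ => Submodule.smul_mem _ _ (hmem j))
    (by
      rw [← hd0, ← Finset.sum_fiberwise J q]
      refine Finset.sum_congr rfl fun ρ _ => ?_
      rw [Finset.sum_mul]
      refine Finset.sum_congr rfl fun j hj => ?_
      rw [← (Finset.mem_filter.1 hj).2, smul_mul_assoc])
  intro j hj
  have h2 : (J.filter fun i => i % orderOf ψ = j % orderOf ψ) = J.filter fun i => q i = q j := by
    ext i; simp [q]
  have h3 := hJ (j % orderOf ψ)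
  rw [linearIndepOn_finset_iff] at h3
  exact h3 d (by rw [h2]; exact hzero (q j)) j (by simp [hj])

theorem FullPowers.mul_of_dvd (h : SpinFrame Γ) (hd : ψ.Disjoint χ)
    (huniv : ψ.support ≠ Finset.univ) (hψ : FullPowers Γ ψ) (hχ : orderOf χ ∣ orderOf ψ) :
    FullPowers Γ (ψ * χ) := by
  intro Z hZ
  obtain ⟨Y, hY⟩ := IsLift.exists_lift h χ
  refine hY.mul_pow_linearIndepOn h hd huniv hψ (fun r => ?_) hZ
  refine ((linearIndepOn_singleton_iff ℂ (i := r)).2 (hY.pow r).ne_zero).mono ?_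
  intro j hj
  simp only [Finset.coe_filter, Finset.mem_range, Set.mem_ofPred_eq] at hj
  rw [hd.orderOf, Nat.lcm_eq_left hχ] at hj
  rw [Set.mem_singleton_iff, ← hj.2, Nat.mod_eq_of_lt hj.1]

theorem FullPowers.mul (h : SpinFrame Γ) (hd : ψ.Disjoint χ)
    (huniv : ψ.support ≠ Finset.univ) (hψ : FullPowers Γ ψ) (hχ : FullPowers Γ χ) :
    FullPowers Γ (ψ * χ) := by
  intro Z hZ
  obtain ⟨Y, hY⟩ := IsLift.exists_lift h χ
  refine hY.mul_pow_linearIndepOn h hd huniv hψ (fun r => ?_) hZ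
  set s := (Finset.range (orderOf (ψ * χ))).filter (fun j => j % orderOf ψ = r)
  have hc : ∀ j, ∃ c : ℂ, c ≠ 0 ∧ Y ^ j = c • Y ^ (j % orderOf χ) := by
    intro j
    have h1 := hY.pow (j % orderOf χ)
    rw [pow_mod_orderOf] at h1
    obtain ⟨c, hc, h2⟩ := (hY.pow j).unique h h1
    exact ⟨c, norm_ne_zero_iff.1 (by rw [hc]; exact one_ne_zero), h2⟩
  choose c hc hYc using hc
  refine LinearIndepOn.of_eq_smul (f := fun j => Y ^ (j % orderOf χ)) ?_ (fun i _ => hc i)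
    (fun i _ => hYc i)
  refine (hχ Y hY).linearIndependent.comp
    (fun j : s => (⟨(j : ℕ) % orderOf χ, by
      simpa using Nat.mod_lt _ (orderOf_pos χ)⟩ : (Finset.range (orderOf χ) : Set ℕ))) ?_
  rintro ⟨i, hi⟩ ⟨j, hj⟩ hij
  have hij' : i % orderOf χ = j % orderOf χ := congrArg Subtype.val hij
  rw [Finset.mem_filter, Finset.mem_range, hd.orderOf] at hi hj
  have h1 : i ≡ j [MOD orderOf ψ] := hi.2.trans hj.2.symm
  have h2 : i ≡ j [MOD Nat.lcm (orderOf ψ) (orderOf χ)] :=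
    Nat.modEq_of_dvd (Int.natCast_dvd.2 (Nat.lcm_dvd
      (Int.natCast_dvd.1 (Nat.ModEq.dvd h1)) (Int.natCast_dvd.1 (Nat.ModEq.dvd hij'))))
  exact Subtype.ext (Nat.ModEq.eq_of_lt_of_lt h2 hi.1 hj.1)

theorem FullPowers.one : FullPowers Γ (1 : Equiv.Perm ι) := by
  intro X hX
  rw [orderOf_one]
  simp

theorem sub_one_lt_two_pow {l : ℕ} (h3 : ¬ 3 ∣ l) (h5 : l ≠ 5) : l - 1 < 2 ^ ((l + 2) / 3) := by
  have key : ∀ q, 4 ≤ q → 3 * q < 2 ^ q + 1 := by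
    intro q hq
    induction q, hq using Nat.le_induction with
    | base => norm_num
    | succ q hq ih => rw [pow_succ]; omega
  rcases Nat.lt_or_ge l 10 with hl | hl
  · interval_cases l <;> omega
  · have := key ((l + 2) / 3) (by omega)
    omega

theorem fullPowers_of_cycleType (h : SpinFrame Γ) (ψ : Equiv.Perm ι)
    (hψ : ∀ l ∈ ψ.cycleType, ¬ 3 ∣ l ∧ l ≠ 5) (huniv : ψ.support ≠ Finset.univ) :
    FullPowers Γ ψ := by
  induction ψ using Equiv.Perm.cycle_induction_on with
  | base_one => exact .one
  | base_cycles σ hσ =>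
    rw [hσ.cycleType] at hψ
    obtain ⟨h1, h2⟩ := hψ _ (Multiset.mem_singleton_self _)
    refine fullPowers_of_card_support h huniv (N := σ.support.card) (fun j hj hlt => ?_) ?_
    · rw [hσ.support_pow_eq_iff.2 (Nat.not_dvd_of_pos_of_lt hj hlt)]
    · rw [hσ.orderOf]
      exact sub_one_lt_two_pow h1 h2
  | induction_disjoint σ τ hd hσ ihσ ihτ =>
    rw [hd.cycleType_mul] at hψ
    rw [hd.support_mul] at huniv
    refine FullPowers.mul h hd (fun h => huniv (by simp [h])) (ihσ ?_ ?_) (ihτ ?_ ?_)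
    · exact fun l hl => hψ l (Multiset.mem_add.2 (Or.inl hl))
    · exact fun h => huniv (by simp [h])
    · exact fun l hl => hψ l (Multiset.mem_add.2 (Or.inr hl))
    · exact fun h => huniv (by simp [h])

theorem not_dvd_orderOf_of_cycleType {p : ℕ} (hp : p.Prime) {σ : Equiv.Perm ι}
    (h : ∀ l ∈ σ.cycleType, ¬ p ∣ l) : ¬ p ∣ orderOf σ := by
  rw [← Equiv.Perm.lcm_cycleType]
  generalize σ.cycleType = s at h
  induction s using Multiset.induction_on with
  | empty => simpa using hp.one_lt.ne'
  | cons a s ih =>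
    rw [Multiset.lcm_cons]
    intro hd
    rcases hp.dvd_mul.1 (hd.trans (lcm_dvd_mul a s.lcm)) with h1 | h1
    · exact h a (Multiset.mem_cons_self a s) h1
    · exact ih (fun l hl => h l (Multiset.mem_cons_of_mem hl)) h1

theorem exists_disjoint_filter (p : ℕ → Prop) [DecidablePred p] (σ : Equiv.Perm ι) :
    ∃ α β : Equiv.Perm ι, σ = α * β ∧ α.Disjoint β ∧ α.cycleType = σ.cycleType.filter p ∧
      β.cycleType = σ.cycleType.filter fun l => ¬ p l := by
  induction σ using Equiv.Perm.cycle_induction_on with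
  | base_one => exact ⟨1, 1, by simp, Equiv.Perm.disjoint_one_left _, by simp, by simp⟩
  | base_cycles σ hσ =>
    by_cases hp : p σ.support.card
    · exact ⟨σ, 1, by simp, Equiv.Perm.disjoint_one_right _, by simp [hσ.cycleType, Multiset.filter_singleton, hp],
        by simp [hσ.cycleType, Multiset.filter_singleton, hp]⟩
    · exact ⟨1, σ, by simp, Equiv.Perm.disjoint_one_left _, by simp [hσ.cycleType, Multiset.filter_singleton, hp],
        by simp [hσ.cycleType, Multiset.filter_singleton, hp]⟩
  | induction_disjoint σ τ hd hσ _ ih =>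
    obtain ⟨α, β, rfl, hαβ, h1, h2⟩ := ih
    have hd' : _root_.Disjoint σ.support (α.support ∪ β.support) := by
      rw [← hαβ.support_mul]
      exact Equiv.Perm.disjoint_iff_disjoint_support.1 hd
    rw [Finset.disjoint_union_right] at hd'
    have hσα : σ.Disjoint α := Equiv.Perm.disjoint_iff_disjoint_support.2 hd'.1
    have hσβ : σ.Disjoint β := Equiv.Perm.disjoint_iff_disjoint_support.2 hd'.2
    rw [hd.cycleType_mul, Multiset.filter_add, Multiset.filter_add, ← h1, ← h2, hσ.cycleType]
    by_cases hp : p σ.support.card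
    · refine ⟨σ * α, β, (mul_assoc _ _ _).symm, Equiv.Perm.Disjoint.mul_left hσβ hαβ, ?_, ?_⟩
      · simp [hσα.cycleType_mul, hσ.cycleType, Multiset.filter_singleton, hp]
      · simp [Multiset.filter_singleton, hp]
    · refine ⟨α, σ * β, ?_, Equiv.Perm.Disjoint.mul_right hσα.symm hαβ, ?_, ?_⟩
      · rw [← mul_assoc, hσα.commute.eq, mul_assoc]
      · simp [Multiset.filter_singleton, hp]
      · simp [hσβ.cycleType_mul, hσ.cycleType, Multiset.filter_singleton, hp]

theorem fullPowers_of_not_solitary_five (h : SpinFrame Γ) (ψ : Equiv.Perm ι)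
    (hψ3 : ∀ l ∈ ψ.cycleType, ¬ 3 ∣ l) (hψ5 : ψ.cycleType.filter (fun l => 5 ∣ l) ≠ {5})
    (huniv : ψ.support ≠ Finset.univ) : FullPowers Γ ψ := by
  obtain ⟨β, α, rfl, hd, hβ, hα⟩ := exists_disjoint_filter (fun l => l ≠ 5) ψ
  simp only [ne_eq, not_not] at hα
  rw [hd.support_mul] at huniv
  have hβu : β.support ≠ Finset.univ := fun h => huniv (by simp [h])
  have hαu : α.support ≠ Finset.univ := fun h => huniv (by simp [h])
  have hFβ : FullPowers Γ β := by
    refine fullPowers_of_cycleType h β (fun l hl => ?_) hβu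
    rw [hβ, Multiset.mem_filter] at hl
    exact ⟨hψ3 l hl.1, hl.2⟩
  have hrep : α.cycleType = Multiset.replicate (α.cycleType.card) 5 := by
    rw [Multiset.eq_replicate]
    refine ⟨rfl, fun b hb => ?_⟩
    rw [hα, Multiset.mem_filter] at hb
    exact hb.2
  have hord : orderOf α ∣ 5 := by
    rw [← Equiv.Perm.lcm_cycleType, Multiset.lcm_dvd, hrep]
    intro b hb
    rw [Multiset.eq_of_mem_replicate hb]
  by_cases h5 : 5 ∣ orderOf β
  · exact hFβ.mul_of_dvd h hd hβu (hord.trans h5)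
  refine hFβ.mul h hd hβu ?_
  rcases (Nat.dvd_prime Nat.prime_five).1 hord with h1 | h1
  · rw [orderOf_eq_one_iff.1 h1]; exact .one
  have hcard : 2 ≤ α.cycleType.card := by
    by_contra hlt
    have hc0 : α.cycleType.card ≠ 0 := fun h0 => by
      rw [Multiset.card_eq_zero, Equiv.Perm.cycleType_eq_zero] at h0
      simp [h0] at h1
    have hc1 : α.cycleType.card = 1 := by omega
    apply hψ5
    rw [hd.cycleType_mul, Multiset.filter_add, hrep, hc1, Multiset.filter_eq_nil.2]
    · simp
    · exact fun l hl hl5 => h5 (hl5.trans (Equiv.Perm.dvd_of_mem_cycleType hl))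
  refine fullPowers_of_card_support h hαu (N := 10) (fun j hj hlt => ?_) (by rw [h1]; norm_num)
  rw [Equiv.Perm.support_pow_coprime, ← Equiv.Perm.sum_cycleType, hrep]
  · simp; omega
  · rw [h1] at hlt ⊢
    interval_cases j <;> decide

/-- A lift of a permutation in which `3` but not `5` is a solitary part has many independent
powers. -/
theorem IsLift.pow_linearIndepOn_of_threeCycle (h : SpinFrame Γ) {α : Equiv.Perm ι}
    (hd : ψ.Disjoint α) (hα : α.IsThreeCycle) (hψ3 : ∀ l ∈ ψ.cycleType, ¬ 3 ∣ l)
    (hψ5 : ψ.cycleType.filter (fun l => 5 ∣ l) ≠ {5}) (hι : 3 < Fintype.card ι)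
    {Z : End ℂ V} (hZ : IsLift Γ (ψ * α) Z) :
    LinearIndepOn ℂ (fun j : ℕ => Z ^ j) (Finset.range (2 * orderOf ψ) : Set ℕ) := by
  have hψu : ψ.support ≠ Finset.univ := by
    intro hcon
    have h1 := Equiv.Perm.disjoint_iff_disjoint_support.1 hd
    rw [hcon] at h1
    have h2 : α.support = ∅ := disjoint_self.1 (h1.mono_left (Finset.subset_univ _))
    have := hα.card_support
    rw [h2] at this
    simp at this
  have hαu : α.support ≠ Finset.univ := by
    intro hcon
    have := hα.card_support
    rw [hcon, Finset.card_univ] at this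
    omega
  have hm3 : ¬ 3 ∣ orderOf ψ := not_dvd_orderOf_of_cycleType Nat.prime_three hψ3
  obtain ⟨Y, hY⟩ := IsLift.exists_lift h α
  refine hY.mul_pow_linearIndepOn h hd hψu (fullPowers_of_not_solitary_five h ψ hψ3 hψ5 hψu)
    (fun r => ?_) hZ
  set m := orderOf ψ
  refine (hY.pow_linearIndepOn h hαu (s := {r, r + m}) (N := 3) ?_ ?_).mono ?_
  · intro i hi j hj hij
    have : j - i = m := by
      simp only [Finset.mem_insert, Finset.mem_singleton] at hi hj
      omega
    rw [this, hα.isCycle.support_pow_eq_iff.2 (by rwa [hα.orderOf]), hα.card_support]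
  · have := Finset.card_le_two (a := r) (b := r + m)
    norm_num
    omega
  · intro j hj
    simp only [Finset.coe_filter, Finset.mem_range, Set.mem_ofPred_eq] at hj
    simp only [Finset.coe_insert, Finset.coe_singleton, Set.mem_insert_iff, Set.mem_singleton_iff]
    rcases Nat.lt_or_ge j m with h1 | h1
    · left; rw [← hj.2, Nat.mod_eq_of_lt h1]
    · right
      rw [← hj.2, Nat.mod_eq_sub_mod h1, Nat.mod_eq_of_lt (by omega)]
      omega

end Powers

/-! ### The Clifford frame of a basic spin module -/

section Frame

variable {V : Type*} [NormedAddCommGroup V] [InnerProductSpace ℂ V] [FiniteDimensional ℂ V]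
set_option linter.unusedSectionVars false

variable {s : ℕ → End ℂ V} {n : ℕ}

/-- Clifford generators whose successive differences are the given generators. -/
def cliffGen (s : ℕ → End ℂ V) (k : ℕ) : End ℂ V := -∑ j ∈ Finset.range k, s j

theorem cliffGen_succ (k : ℕ) : cliffGen s (k + 1) = cliffGen s k - s k := by
  simp only [cliffGen, Finset.sum_range_succ]
  abel

theorem cliffGen_zero : cliffGen s 0 = 0 := by simp [cliffGen]

theorem SpinRel.anticomm (h : SpinRel s n)
    (hb : ∀ i, i + 2 < n → s i * s (i + 1) + s (i + 1) * s i = 1) {j l : ℕ} (hj : j + 1 < n)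
    (hl : l + 1 < n) : s j * s l + s l * s j =
      ((if j = l then -2 else 0) + (if l = j + 1 then 1 else 0) +
        (if l + 1 = j then 1 else 0) : ℂ) • 1 := by
  rcases lt_trichotomy j l with hjl | rfl | hjl
  · rcases Nat.lt_or_ge (j + 1) l with h1 | h1
    · rw [h.far _ _ h1 hl, if_neg (by omega), if_neg (by omega), if_neg (by omega)]
      simp
    · obtain rfl : l = j + 1 := by omega
      rw [hb j hl, if_neg (by omega), if_pos rfl, if_neg (by omega)]
      simp
  · rw [h.sq j hj, if_pos rfl, if_neg (by omega), if_neg (by omega)]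
    rw [add_zero, add_zero, neg_smul, two_smul, neg_add]
  · rcases Nat.lt_or_ge (l + 1) j with h1 | h1
    · rw [h.far _ _ h1 hj, if_neg (by omega), if_neg (by omega), if_neg (by omega)]
      simp
    · obtain rfl : j = l + 1 := by omega
      rw [add_comm, hb l hj, if_neg (by omega), if_neg (by omega), if_pos rfl]
      simp

theorem SpinRel.anticomm_cliffGen (h : SpinRel s n)
    (hb : ∀ i, i + 2 < n → s i * s (i + 1) + s (i + 1) * s i = 1) {j k : ℕ} (hj : j + 1 < n)
    (hk : k < n) : s j * cliffGen s k + cliffGen s k * s j =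
      ((if k = j + 1 then 1 else 0) - (if k = j then 1 else 0) +
        (if j = 0 then 1 else 0) : ℂ) • 1 := by
  induction k with
  | zero =>
    rw [cliffGen_zero, if_neg (by omega)]
    by_cases h0 : j = 0 <;> simp [h0, eq_comm]
  | succ k ih =>
    have h1 : s j * cliffGen s (k + 1) + cliffGen s (k + 1) * s j =
        (s j * cliffGen s k + cliffGen s k * s j) - (s j * s k + s k * s j) := by
      rw [cliffGen_succ]; noncomm_ring
    rw [h1, ih (by omega), h.anticomm hb hj hk, ← sub_smul]
    congr 1
    split_ifs <;> first | contradiction | omega | norm_num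

theorem SpinRel.cliffGen_anticomm (h : SpinRel s n)
    (hb : ∀ i, i + 2 < n → s i * s (i + 1) + s (i + 1) * s i = 1) {i k : ℕ} (hi : i < n)
    (hk : k < n) : cliffGen s i * cliffGen s k + cliffGen s k * cliffGen s i =
      (-(if i = k then 1 else 0) - 1 + (if i = 0 then 1 else 0) +
        (if k = 0 then 1 else 0) : ℂ) • 1 := by
  induction i with
  | zero =>
    rw [cliffGen_zero]
    by_cases h0 : k = 0 <;> simp [h0, eq_comm]
  | succ i ih =>
    have h1 : cliffGen s (i + 1) * cliffGen s k + cliffGen s k * cliffGen s (i + 1) =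
        (cliffGen s i * cliffGen s k + cliffGen s k * cliffGen s i) -
          (s i * cliffGen s k + cliffGen s k * s i) := by
      rw [cliffGen_succ]; noncomm_ring
    rw [h1, ih (by omega), h.anticomm_cliffGen hb hi hk, ← sub_smul]
    congr 1
    split_ifs <;> first | contradiction | omega | norm_num

/-- The linear extension of `cliffGen` to real coefficient vectors. -/
noncomputable def cliff (s : ℕ → End ℂ V) (n : ℕ) (f : Fin n → ℝ) : End ℂ V :=
  ∑ i, (f i : ℂ) • cliffGen s i

theorem cliff_rootVec {i j : Fin n} (hij : (j : ℕ) = i + 1) :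
    cliff s n (rootVec i j) = s i := by
  have h1 : ∀ a : Fin n, cliff s n (Pi.single a 1) = cliffGen s a := by
    intro a
    rw [cliff, Finset.sum_eq_single a]
    · simp
    · intro b _ hb; simp [hb]
    · simp
  have h2 : cliff s n (rootVec i j) = cliff s n (Pi.single i 1) - cliff s n (Pi.single j 1) := by
    simp only [cliff, rootVec, Pi.sub_apply, Complex.ofReal_sub, sub_smul, Finset.sum_sub_distrib]
  rw [h2, h1, h1, hij, cliffGen_succ]
  abel

theorem SpinRel.spinFrame (h : SpinRel s n) (hskew : ∀ i, i + 1 < n → IsSkew (s i))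
    (hb : ∀ i, i + 2 < n → s i * s (i + 1) + s (i + 1) * s i = 1)
    (hsc : ∀ X : End ℂ V, (∀ i, i + 1 < n → X * s i = s i * X) → ∃ c : ℂ, X = c • 1) :
    SpinFrame (cliff s n) where
  add f g := by
    simp only [cliff, Pi.add_apply, Complex.ofReal_add, add_smul, Finset.sum_add_distrib]
  smul r f := by
    simp only [cliff, Pi.smul_apply, smul_eq_mul, Complex.ofReal_mul, mul_smul, Finset.smul_sum]
  adjoint f _ := by
    have h1 : ∀ i : Fin n, LinearMap.adjoint (cliffGen s i) = -cliffGen s i := by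
      intro i
      have h2 : ∀ j ∈ Finset.range i, LinearMap.adjoint (s j) = -s j := by
        intro j hj
        rw [Finset.mem_range] at hj
        refine ((LinearMap.eq_adjoint_iff _ _).2 fun v w => ?_).symm
        rw [LinearMap.neg_apply, inner_neg_left, hskew j (by omega), neg_neg]
      rw [cliffGen, map_neg, map_sum, Finset.sum_congr rfl h2, Finset.sum_neg_distrib]
    simp only [cliff, map_sum, map_smulₛₗ, Complex.conj_ofReal, h1, smul_neg,
      Finset.sum_neg_distrib]
  rel f g hf hg := by
    have h1 : cliff s n f * cliff s n g + cliff s n g * cliff s n f =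
        ∑ i, ∑ k, ((f i : ℂ) * (g k : ℂ)) •
          (cliffGen s i * cliffGen s k + cliffGen s k * cliffGen s i) := by
      simp only [smul_add, Finset.sum_add_distrib, cliff, Finset.sum_mul_sum, smul_mul_smul_comm]
      congr 1
      rw [Finset.sum_comm]
      simp only [mul_comm]
    have hf' : ∑ i, (f i : ℂ) = 0 := by exact_mod_cast congrArg Complex.ofReal hf
    have hg' : ∑ i, (g i : ℂ) = 0 := by exact_mod_cast congrArg Complex.ofReal hg
    have h2 : ∀ i k : Fin n, ((f i : ℂ) * (g k : ℂ)) •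
          (cliffGen s i * cliffGen s k + cliffGen s k * cliffGen s i) =
        ((f i : ℂ) * (g k : ℂ) * (-(if i = k then 1 else 0) - 1 +
          (if (i : ℕ) = 0 then 1 else 0) + (if (k : ℕ) = 0 then 1 else 0))) • 1 := by
      intro i k
      rw [h.cliffGen_anticomm hb i.2 k.2, smul_smul]
      simp only [Fin.ext_iff]
    simp only [h1, h2, ← Finset.sum_smul]
    congr 1
    have h3 : ∀ i k : Fin n, (f i : ℂ) * (g k : ℂ) * (-(if i = k then 1 else 0) - 1 +
          (if (i : ℕ) = 0 then 1 else 0) + (if (k : ℕ) = 0 then 1 else 0)) =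
        -(if i = k then (f i : ℂ) * g k else 0) + (f i * (-1 + if (i : ℕ) = 0 then 1 else 0)) * g k
          + f i * (g k * if (k : ℕ) = 0 then 1 else 0) := by
      intro i k; split_ifs <;> ring
    simp only [h3, Finset.sum_add_distrib, ← Finset.mul_sum, hg', ← Finset.sum_mul, hf',
      Finset.sum_neg_distrib, Finset.sum_ite_eq, Finset.mem_univ, if_true, mul_zero, zero_mul,
      add_zero]
    push_cast
    rfl
  scalar X hX := by
    refine hsc X fun i hi => ?_
    have := hX (rootVec ⟨i, by omega⟩ ⟨i + 1, hi⟩) (sum_rootVec _ _)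
    rwa [cliff_rootVec rfl] at this

end Frame

/-! ### Invariant inner products -/

section Finite

variable {R : Type*} [Ring R] {s : ℕ → R} {n : ℕ}

/-- The descending product `s_k s_{k-1} ⋯` with `j` factors. -/
def descProd (s : ℕ → R) (k : ℕ) : ℕ → R
  | 0 => 1
  | j + 1 => descProd s k j * s (k - j)

namespace SpinRel

theorem descProd_mul_low (h : SpinRel s n) {k : ℕ} (hk : k + 1 < n) {i j : ℕ} (hij : i + j < k) :
    descProd s k j * s i = s i * descProd s k j ∨
      descProd s k j * s i = -(s i * descProd s k j) := by
  induction j with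
  | zero => simp [descProd]
  | succ j ih =>
    have h1 : descProd s k (j + 1) * s i = -(descProd s k j * s i * s (k - j)) := by
      rw [descProd, mul_assoc, ← neg_eq_iff_eq_neg.2 (h.far i (k - j) (by omega) (by omega)),
        mul_neg, mul_assoc]
    rw [h1, descProd, ← mul_assoc]
    rcases ih (by omega) with h2 | h2 <;> rw [h2]
    · exact Or.inr rfl
    · left; noncomm_ring

theorem descProd_mul_high (h : SpinRel s n) {k : ℕ} (hk : k + 1 < n) {i j : ℕ} (hi : i + 1 ≤ k)
    (hj : j ≤ k + 1) (hij : k + 1 ≤ i + j) :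
    descProd s k j * s (i + 1) = s i * descProd s k j ∨
      descProd s k j * s (i + 1) = -(s i * descProd s k j) := by
  induction j with
  | zero => omega
  | succ j ih =>
    rcases Nat.eq_or_lt_of_le hij with he | hlt
    · obtain ⟨l, rfl⟩ : ∃ l, j = l + 1 := ⟨j - 1, by omega⟩
      have h1 : descProd s k (l + 1 + 1) * s (i + 1) =
          descProd s k l * s i * s (i + 1) * s i := by
        rw [descProd, descProd, show k - (l + 1) = i by omega, show k - l = i + 1 by omega]
        simp only [mul_assoc]
        rw [← mul_assoc (s (i + 1)), ← h.braid i (by omega), mul_assoc]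
      have h2 : descProd s k (l + 1 + 1) = descProd s k l * s (i + 1) * s i := by
        rw [descProd, descProd, show k - (l + 1) = i by omega, show k - l = i + 1 by omega]
      rw [h1, h2]
      rcases h.descProd_mul_low hk (i := i) (j := l) (by omega) with h3 | h3 <;> rw [h3]
      · left; noncomm_ring
      · right; noncomm_ring
    · have h1 : descProd s k (j + 1) * s (i + 1) = -(descProd s k j * s (i + 1) * s (k - j)) := by
        rw [descProd, mul_assoc, h.far (k - j) (i + 1) (by omega) (by omega), mul_neg, mul_assoc]
      rw [h1, descProd, ← mul_assoc]
      rcases ih (by omega) (by omega) with h2 | h2 <;> rw [h2]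
      · exact Or.inr rfl
      · left; noncomm_ring

/-- The group generated by the `s_i` is finite. -/
theorem exists_finite (h : SpinRel s n) (k : ℕ) (hk : k + 1 ≤ n) :
    ∃ F : Set R, F.Finite ∧ 1 ∈ F ∧ (∀ f ∈ F, -f ∈ F) ∧ ∀ f ∈ F, ∀ i < k, f * s i ∈ F := by
  induction k with
  | zero => exact ⟨{1, -1}, by simp, by simp, by simp, by simp⟩
  | succ k ih =>
    obtain ⟨F, hF, h1, hneg, hmul⟩ := ih (by omega)
    refine ⟨Set.image2 (fun f j => f * descProd s k j) F (Set.Iic (k + 1)),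
      hF.image2 _ (Set.finite_Iic _), ⟨1, h1, 0, by simp, by simp [descProd]⟩, ?_, ?_⟩
    · rintro _ ⟨f, hf, j, hj, rfl⟩
      exact ⟨-f, hneg f hf, j, hj, by simp⟩
    · rintro _ ⟨f, hf, j, hj, rfl⟩ i hi
      rw [Set.mem_Iic] at hj
      have key : ∀ l < k, (descProd s k j * s i = s l * descProd s k j ∨
          descProd s k j * s i = -(s l * descProd s k j)) → f * descProd s k j * s i ∈
          Set.image2 (fun f j => f * descProd s k j) F (Set.Iic (k + 1)) := by
        intro l hl hcase
        rw [mul_assoc]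
        rcases hcase with h2 | h2 <;> rw [h2]
        · exact ⟨f * s l, hmul f hf l hl, j, hj, by simp [mul_assoc]⟩
        · exact ⟨-(f * s l), hneg _ (hmul f hf l hl), j, hj, by simp [mul_assoc]⟩
      rcases Nat.lt_or_ge (i + j) k with hlt | hge
      · exact key i (by omega) (h.descProd_mul_low hk hlt)
      rcases Nat.eq_or_lt_of_le hge with he | hlt
      · refine ⟨f, hf, j + 1, by simp; omega, ?_⟩
        simp only [descProd, show k - j = i by omega, mul_assoc]
      rcases Nat.eq_or_lt_of_le hlt with he | hlt
      · obtain ⟨l, rfl⟩ : ∃ l, j = l + 1 := ⟨j - 1, by omega⟩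
        refine ⟨-f, hneg f hf, l, by simp; omega, ?_⟩
        simp only [descProd, show k - l = i by omega, mul_assoc, h.sq i (by omega)]
        simp
      · obtain ⟨l, rfl⟩ : ∃ l, i = l + 1 := ⟨i - 1, by omega⟩
        exact key l (by omega) (h.descProd_mul_high hk (by omega) hj (by omega))

end SpinRel

end Finite

section Invariant

variable {V : Type*} [AddCommGroup V] [Module ℂ V] [FiniteDimensional ℂ V]
  {s : ℕ → End ℂ V} {n : ℕ}

/-- The Hermitian form obtained by summing the standard one over a finite set of operators. -/
noncomputable abbrev averagedCore (F : Finset (End ℂ V)) (hF : 1 ∈ F) :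
    InnerProductSpace.Core ℂ V where
  inner v w := ∑ f ∈ F, ∑ i, starRingEnd ℂ ((finBasis ℂ V).repr (f v) i) *
    (finBasis ℂ V).repr (f w) i
  conj_inner_symm v w := by
    simp only [map_sum, map_mul, Complex.conj_conj]
    simp only [mul_comm]
  re_inner_nonneg v := by
    simp only [map_sum]
    refine Finset.sum_nonneg fun f _ => Finset.sum_nonneg fun i _ => ?_
    rw [← Complex.normSq_eq_conj_mul_self]
    exact Complex.normSq_nonneg _
  add_left u v w := by
    simp only [map_add, Finsupp.add_apply, add_mul, Finset.sum_add_distrib]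
  smul_left v w c := by
    simp only [map_smul, Finsupp.smul_apply, smul_eq_mul, map_mul, mul_assoc, Finset.mul_sum]
  definite v hv := by
    simp only [← Complex.normSq_eq_conj_mul_self, ← Complex.ofReal_sum] at hv
    rw [Complex.ofReal_eq_zero, Finset.sum_eq_zero_iff_of_nonneg
      (fun f _ => Finset.sum_nonneg fun i _ => Complex.normSq_nonneg _)] at hv
    have h1 := hv 1 hF
    rw [Finset.sum_eq_zero_iff_of_nonneg (fun i _ => Complex.normSq_nonneg _)] at h1
    rw [← (finBasis ℂ V).repr.map_eq_zero_iff]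
    ext i
    simpa using h1 i (Finset.mem_univ i)

open Classical in
theorem SpinRel.exists_core (h : SpinRel s n) :
    ∃ c : InnerProductSpace.Core ℂ V, ∀ i, i + 1 < n → ∀ v w,
      c.inner (s i v) w = -c.inner v (s i w) := by
  rcases Nat.eq_zero_or_pos n with rfl | hn
  · exact ⟨averagedCore {1} (by simp), fun i hi => by omega⟩
  obtain ⟨F, hF, h1, -, hmul⟩ := h.exists_finite (n - 1) (by omega)
  have hmem : ∀ f, f ∈ hF.toFinset ↔ f ∈ F := fun f => hF.mem_toFinset
  refine ⟨averagedCore hF.toFinset ((hmem 1).2 h1), fun i hi v w => ?_⟩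
  set c := averagedCore hF.toFinset ((hmem 1).2 h1) with hc
  have hinv : ∀ v w, c.inner (s i v) (s i w) = c.inner v w := by
    intro v w
    have hinj : Set.InjOn (fun f => f * s i) (hF.toFinset : Set (End ℂ V)) := by
      intro f _ g _ hfg
      have h2 : f * s i * s i = g * s i * s i := congrArg (fun x => x * s i) hfg
      simpa only [mul_assoc, h.sq i hi, mul_neg, mul_one, neg_inj] using h2
    have himg : hF.toFinset.image (fun f => f * s i) = hF.toFinset := by
      refine Finset.eq_of_subset_of_card_le ?_ (Finset.card_image_of_injOn hinj).ge
      intro f hf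
      obtain ⟨g, hg, rfl⟩ := Finset.mem_image.1 hf
      exact (hmem _).2 (hmul g ((hmem g).1 hg) i (by omega))
    change ∑ f ∈ hF.toFinset, _ = ∑ f ∈ hF.toFinset, _
    conv_rhs => rw [← himg, Finset.sum_image hinj]
    rfl
  have hss : ∀ v, s i (s i v) = -v := fun v => by
    have := congrArg (fun x : End ℂ V => x v) (h.sq i hi)
    simpa using this
  have hneg : ∀ v w, c.inner (-v) w = -c.inner v w := by
    intro v w
    have := c.smul_left v w (-1)
    simpa using this
  rw [← hinv (s i v) w, hss, hneg]

end Invariant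

/-! ### Spin representations of Schur's double cover -/

section Cover

open Schur

theorem Schur.z_sq (n : ℕ) : z n ^ 2 = 1 :=
  PresentedGroup.one_of_mem (rels := rels n) (Or.inl rfl)

theorem Schur.t_sq {n : ℕ} (i : Fin (n - 1)) : t n i ^ 2 = z n :=
  mul_inv_eq_one.1 (PresentedGroup.one_of_mem (rels := rels n) (Or.inr (Or.inl ⟨i, rfl⟩)))

theorem Schur.t_mul_t_pow_three {n : ℕ} {i j : Fin (n - 1)} (h : (i : ℕ) + 1 = j) :
    (t n i * t n j) ^ 3 = z n :=
  mul_inv_eq_one.1 (PresentedGroup.one_of_mem (rels := rels n)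
    (Or.inr (Or.inr (Or.inl ⟨i, j, h, rfl⟩))))

theorem Schur.t_mul_t_sq {n : ℕ} {i j : Fin (n - 1)} (h : (i : ℕ) + 2 ≤ j) :
    (t n i * t n j) ^ 2 = z n :=
  mul_inv_eq_one.1 (PresentedGroup.one_of_mem (rels := rels n)
    (Or.inr (Or.inr (Or.inr ⟨i, j, Or.inl h, rfl⟩))))

theorem Schur.cover_induction {n : ℕ} {p : Cover n → Prop} (hz : p (z n)) (ht : ∀ i, p (t n i))
    (h1 : p 1) (hmul : ∀ a b, p a → p b → p (a * b)) (hinv : ∀ a, p a → p a⁻¹) (g : Cover n) :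
    p g := by
  have hg : g ∈ Subgroup.closure (Set.range (PresentedGroup.of (rels := rels n))) := by
    rw [PresentedGroup.closure_range_of]; trivial
  induction hg using Subgroup.closure_induction with
  | mem x hx =>
    obtain ⟨i | i, rfl⟩ := hx
    · exact hz
    · exact ht i
  | one => exact h1
  | mul a b _ _ ha hb => exact hmul a b ha hb
  | inv a _ ha => exact hinv a ha

variable {n : ℕ}

theorem Schur.surjective_of_map_t {π : Cover n →* Equiv.Perm (Fin n)}
    (hπt : ∀ i : Fin (n - 1), π (t n i) = adj n i) : Function.Surjective π := by
  rcases n with _ | n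
  · exact fun σ => ⟨1, Subsingleton.elim _ _⟩
  have h1 : (⊤ : Submonoid (Equiv.Perm (Fin (n + 1)))) ≤ MonoidHom.mrange π := by
    rw [← Equiv.Perm.mclosure_swap_castSucc_succ, Submonoid.closure_le]
    rintro _ ⟨i, rfl⟩
    exact ⟨t (n + 1) i, hπt i⟩
  exact fun σ => h1 (Submonoid.mem_top σ)

section Rep

variable {V : Type*} [AddCommGroup V] [Module ℂ V] {ρ : Cover n →* End ℂ V}

/-- The operators by which the generators act, indexed by natural numbers. -/
def spinGen (ρ : Cover n →* End ℂ V) (i : ℕ) : End ℂ V :=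
  if h : i < n - 1 then ρ (t n ⟨i, h⟩) else 0

theorem spinGen_eq (ρ : Cover n →* End ℂ V) (i : Fin (n - 1)) : spinGen ρ i = ρ (t n i) :=
  dif_pos i.2

theorem spinRel_spinGen (hspin : ρ (z n) = -1) : SpinRel (spinGen ρ) n := by
  have hsq : ∀ i, i + 1 < n → spinGen ρ i * spinGen ρ i = -1 := by
    intro i hi
    rw [spinGen_eq ρ ⟨i, by omega⟩, ← map_mul, ← pow_two, t_sq, hspin]
  refine ⟨hsq, fun i hi => ?_, fun i j hij hj => ?_⟩
  · have h1 : (spinGen ρ i * spinGen ρ (i + 1)) ^ 3 = -1 := by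
      rw [spinGen_eq ρ ⟨i, by omega⟩, spinGen_eq ρ ⟨i + 1, by omega⟩, ← map_mul, ← map_pow,
        t_mul_t_pow_three rfl, hspin]
    have ha := hsq i (by omega)
    have hb := hsq (i + 1) (by omega)
    generalize spinGen ρ i = a at h1 ha ⊢
    generalize spinGen ρ (i + 1) = b at h1 hb ⊢
    have h2 : b * a * b * (b * a * b) = -1 := by
      calc b * a * b * (b * a * b) = b * a * (b * b) * a * b := by noncomm_ring
        _ = -(b * (a * a) * b) := by rw [hb]; noncomm_ring
        _ = _ := by rw [ha, mul_neg_one, neg_mul, hb, neg_neg]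
    calc a * b * a = -(a * b * a * (b * a * b * (b * a * b))) := by rw [h2]; noncomm_ring
      _ = -((a * b) ^ 3 * (b * a * b)) := by noncomm_ring
      _ = b * a * b := by rw [h1]; noncomm_ring
  · have h1 : (spinGen ρ i * spinGen ρ j) ^ 2 = -1 := by
      rw [spinGen_eq ρ ⟨i, by omega⟩, spinGen_eq ρ ⟨j, by omega⟩, ← map_mul, ← map_pow,
        t_mul_t_sq hij, hspin]
    have ha := hsq i (by omega)
    have hb := hsq j (by omega)
    generalize spinGen ρ i = a at h1 ha ⊢
    generalize spinGen ρ j = b at h1 hb ⊢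
    calc a * b = -(a * (a * b) ^ 2 * b) := by rw [h1]; noncomm_ring
      _ = -((a * a) * (b * a) * (b * b)) := by noncomm_ring
      _ = _ := by rw [ha, hb]; noncomm_ring

theorem map_mul_map_inv (ρ : Cover n →* End ℂ V) (g : Cover n) : ρ g * ρ g⁻¹ = 1 := by
  rw [← map_mul, mul_inv_cancel, map_one]

theorem map_inv_mul_map (ρ : Cover n →* End ℂ V) (g : Cover n) : ρ g⁻¹ * ρ g = 1 := by
  rw [← map_mul, inv_mul_cancel, map_one]

theorem exists_eq_smul_one_of_commute [FiniteDimensional ℂ V] [Nontrivial V]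
    (hirr : ∀ U : Submodule ℂ V, (∀ h : Cover n, U.map (ρ h) ≤ U) → U = ⊥ ∨ U = ⊤)
    (hspin : ρ (z n) = -1) {X : End ℂ V}
    (hX : ∀ i, i + 1 < n → X * spinGen ρ i = spinGen ρ i * X) : ∃ c : ℂ, X = c • 1 := by
  have hcomm : ∀ g, X * ρ g = ρ g * X := by
    intro g
    induction g using cover_induction with
    | hz => rw [hspin]; noncomm_ring
    | ht i => rw [← spinGen_eq]; exact hX i (by omega)
    | h1 => rw [map_one, mul_one, one_mul]
    | hmul a b ha hb => rw [map_mul, ← mul_assoc, ha, mul_assoc, hb, mul_assoc]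
    | hinv a ha =>
      calc X * ρ a⁻¹ = ρ a⁻¹ * (ρ a * X) * ρ a⁻¹ := by
            rw [← mul_assoc, map_inv_mul_map, one_mul]
        _ = ρ a⁻¹ * X * (ρ a * ρ a⁻¹) := by rw [← ha]; simp only [mul_assoc]
        _ = _ := by rw [map_mul_map_inv, mul_one]
  obtain ⟨c, hc⟩ := Module.End.exists_eigenvalue X
  refine ⟨c, ?_⟩
  have hinv : ∀ h : Cover n, (X.eigenspace c).map (ρ h) ≤ X.eigenspace c := by
    rintro h _ ⟨v, hv, rfl⟩
    rw [SetLike.mem_coe, Module.End.mem_eigenspace_iff] at hv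
    rw [Module.End.mem_eigenspace_iff]
    have := LinearMap.congr_fun (hcomm h) v
    simp only [Module.End.mul_apply] at this
    rw [this, hv, map_smul]
  rcases hirr _ hinv with h0 | h0
  · exact absurd h0 hc
  · ext v
    have : v ∈ X.eigenspace c := by rw [h0]; trivial
    simpa using Module.End.mem_eigenspace_iff.1 this

theorem det_map_pow_four (ρ : Cover n →* End ℂ V) (g : Cover n) :
    LinearMap.det (ρ g) ^ 4 = 1 := by
  induction g using cover_induction with
  | hz => rw [← map_pow, ← map_pow, pow_mul _ 2 2, z_sq, one_pow, map_one, map_one]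
  | ht i => rw [← map_pow, ← map_pow, pow_mul _ 2 2, t_sq, z_sq, map_one, map_one]
  | h1 => rw [map_one, map_one, one_pow]
  | hmul a b ha hb => rw [map_mul, map_mul, mul_pow, ha, hb, one_mul]
  | hinv a ha =>
    have h1 := congrArg LinearMap.det (map_mul_map_inv ρ a)
    rw [map_mul, map_one] at h1
    rw [← one_mul (LinearMap.det (ρ a⁻¹) ^ 4), ← ha, ← mul_pow, h1, one_pow, ha]

end Rep

theorem isLift_map {V : Type*} [NormedAddCommGroup V] [InnerProductSpace ℂ V]
    [FiniteDimensional ℂ V] {ρ : Cover n →* End ℂ V} {π : Cover n →* Equiv.Perm (Fin n)}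
    (hπt : ∀ i : Fin (n - 1), π (t n i) = adj n i) (hπz : π (z n) = 1) (hspin : ρ (z n) = -1)
    (h : SpinFrame (cliff (spinGen ρ) n)) (g : Cover n) :
    IsLift (cliff (spinGen ρ) n) (π g) (ρ g) := by
  induction g using cover_induction with
  | hz =>
    rw [hπz, hspin, ← neg_one_smul ℂ]
    exact IsLift.one.smul (by simp)
  | ht i =>
    have h1 : ρ (t n i) = cliff (spinGen ρ) n (rootVec ⟨i, by omega⟩ ⟨i + 1, by omega⟩) := by
      rw [cliff_rootVec rfl, spinGen_eq]
    rw [h1, hπt]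
    exact IsLift.root h (by simp)
  | h1 => rw [map_one, map_one]; exact .one
  | hmul a b ha hb => rw [map_mul, map_mul]; exact ha.mul hb
  | hinv a ha =>
    have h1 : ρ a⁻¹ = LinearMap.adjoint (ρ a) := by
      rw [← one_mul (ρ a⁻¹), ← ha.unit, mul_assoc, map_mul_map_inv, mul_one]
    rw [map_inv, h1]
    exact ha.adjoint

end Cover

/-! ### Minimal polynomials -/

section Minpoly

open Schur Polynomial

theorem eq_neg_of_pow_three_eq_neg {c ε : ℂ} {j : ℕ} (hε : ε ^ 2 = 1) (h3 : c ^ 3 = -ε)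
    (hj : c ^ 2 ^ j = 1) : c = -ε := by
  have h6 : c ^ 6 = 1 := by
    rw [show 6 = 3 * 2 by norm_num, pow_mul, h3, neg_sq, hε]
  obtain ⟨i, -, hi⟩ := (Nat.dvd_prime_pow Nat.prime_two).1 (orderOf_dvd_of_pow_eq_one hj)
  have h2 : orderOf c ∣ 2 := by
    have h7 : orderOf c ∣ 2 * 3 := orderOf_dvd_of_pow_eq_one h6
    refine Nat.Coprime.dvd_of_dvd_mul_right ?_ h7
    rw [hi]
    exact Nat.Coprime.pow_left _ (by norm_num)
  have h8 : c ^ 2 = 1 := orderOf_dvd_iff_pow_eq_one.1 h2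
  rw [← h3, pow_succ, h8, one_mul]

theorem minpoly_eq_of_linearIndepOn {A : Type*} [Ring A] [Algebra ℂ A] {a : A} {q : ℂ[X]}
    (hq : q.Monic) (hqa : aeval a q = 0)
    (hli : LinearIndepOn ℂ (fun j : ℕ => a ^ j) (Finset.range q.natDegree : Set ℕ)) :
    minpoly ℂ a = q := by
  have h_integral : IsIntegral ℂ a := ⟨q, hq, hqa⟩
  refine (Polynomial.eq_of_monic_of_dvd_of_natDegree_le (minpoly.monic h_integral) hq
    (minpoly.dvd ℂ a hqa) ?_).symm
  by_contra! hlt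
  have h1 := minpoly.aeval ℂ a
  rw [aeval_eq_sum_range' hlt] at h1
  rw [linearIndepOn_finset_iff] at hli
  have h2 := hli _ h1 _ (Finset.mem_range.2 hlt)
  rw [(minpoly.monic h_integral).coeff_natDegree] at h2
  exact one_ne_zero h2

theorem minpoly_mul_eq {A : Type*} [Ring A] [Algebra ℂ A] {a : A} {m : ℕ} (hm : 0 < m) {ε : ℂ}
    (hε : ε ^ 2 = 1) (ha : a ^ (2 * m) + ε • a ^ m + 1 = 0)
    (hli : LinearIndepOn ℂ (fun j : ℕ => a ^ j) (Finset.range (2 * m) : Set ℕ)) :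
    minpoly ℂ a * (X ^ m - C ε) = X ^ (3 * m) - C ε := by
  have hdeg : (C ε * X ^ m + 1 : ℂ[X]).degree < ((2 * m : ℕ) : WithBot ℕ) := by
    refine (degree_add_le _ _).trans_lt (max_lt ?_ ?_)
    · exact (degree_C_mul_X_pow_le m ε).trans_lt (by exact_mod_cast (by omega : m < 2 * m))
    · rw [degree_one]
      exact_mod_cast (by omega : 0 < 2 * m)
  have hmonic : (X ^ (2 * m) + (C ε * X ^ m + 1) : ℂ[X]).Monic := monic_X_pow_add hdeg
  have hnat : (X ^ (2 * m) + (C ε * X ^ m + 1) : ℂ[X]).natDegree = 2 * m := by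
    refine natDegree_eq_of_degree_eq_some ?_
    rw [degree_add_eq_left_of_degree_lt (by rwa [degree_X_pow]), degree_X_pow]
  rw [minpoly_eq_of_linearIndepOn hmonic (by
    rw [← add_assoc]; simpa [Algebra.smul_def] using ha) (by rwa [hnat])]
  have h1 : (C ε : ℂ[X]) ^ 2 = 1 := by rw [← C_pow, hε, C_1]
  rw [pow_mul' X 2, pow_mul' X 3]
  linear_combination (-(X ^ m : ℂ[X])) * h1

theorem cycleType_adj_mul_adj {n : ℕ} (hn : 8 < n) :
    (adj n ⟨0, by omega⟩ * adj n ⟨1, by omega⟩).IsThreeCycle := by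
  have h := Equiv.Perm.isThreeCycle_swap_mul_swap_same (a := (⟨1, by omega⟩ : Fin n))
    (b := ⟨0, by omega⟩) (c := ⟨2, by omega⟩) (by simp) (by simp) (by simp)
  rw [Equiv.swap_comm] at h
  exact h

theorem minpoly_map_of_frame {n : ℕ} (hn : 8 < n) {π : Cover n →* Equiv.Perm (Fin n)}
    (hπt : ∀ i : Fin (n - 1), π (t n i) = adj n i) (hπz : π (z n) = 1)
    {g : Cover n} (h3 : SolitaryPart 3 (π g)) (h5 : ¬ SolitaryPart 5 (π g))
    {V : Type*} [NormedAddCommGroup V] [InnerProductSpace ℂ V] [FiniteDimensional ℂ V]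
    [Nontrivial V] {ρ : Cover n →* Module.End ℂ V} (hspin : ρ (z n) = -1)
    (hdim : Module.finrank ℂ V = 2 ^ ((n - 1) / 2))
    (hb : spinGen ρ 0 * spinGen ρ 1 + spinGen ρ 1 * spinGen ρ 0 = 1)
    (h : SpinFrame (cliff (spinGen ρ) n)) {ε : ℂ} (hε : ε ^ 2 = 1)
    (hg : ρ (g ^ orderOf (π g)) = ε • 1) :
    3 ∣ orderOf (π g) ∧
      minpoly ℂ (ρ g) * (X ^ (orderOf (π g) / 3) - C ε) = X ^ orderOf (π g) - C ε := by
  have hl := isLift_map hπt hπz hspin h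
  obtain ⟨α, ψ, hσ, hd, hα, hψ⟩ := exists_disjoint_filter (fun l => 3 ∣ l) (π g)
  have hα3 : α.IsThreeCycle := hα.trans h3
  have hψ3 : ∀ l ∈ ψ.cycleType, ¬ 3 ∣ l := fun l hl => by
    rw [hψ, Multiset.mem_filter] at hl
    exact hl.2
  have hψ5 : ψ.cycleType.filter (fun l => 5 ∣ l) ≠ {5} := fun hcon => by
    apply h5
    have hα' : α.cycleType = {3} := hα3
    rw [SolitaryPart, hσ, hd.cycleType_mul, Multiset.filter_add, hcon, hα',
      Multiset.filter_singleton, if_neg (by norm_num)]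
    simp
  have hm3 := not_dvd_orderOf_of_cycleType Nat.prime_three hψ3
  have hm0 := orderOf_pos ψ
  have hord : orderOf (π g) = 3 * orderOf ψ := by
    rw [hσ, hd.orderOf, hα3.orderOf]
    exact ((Nat.Prime.coprime_iff_not_dvd Nat.prime_three).2 hm3).lcm_eq_mul
  have hpow : π (g ^ orderOf ψ) = α ^ orderOf ψ := by
    rw [map_pow, hσ, hd.commute.mul_pow, pow_orderOf_eq_one, mul_one]
  have hli := IsLift.pow_linearIndepOn_of_threeCycle h hd.symm hα3 hψ3 hψ5
    (by rw [Fintype.card_fin]; omega) (by rw [← hd.commute.eq, ← hσ]; exact hl g)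
  rw [hord] at hg ⊢
  set m := orderOf ψ
  refine ⟨dvd_mul_right 3 m, ?_⟩
  rw [Nat.mul_div_cancel_left m (by norm_num)]
  have hαm : (α ^ m).IsThreeCycle := by
    rw [← card_support_eq_three_iff,
      hα3.isCycle.support_pow_eq_iff.2 (by rwa [hα3.orderOf]), hα3.card_support]
  obtain ⟨γ, hγ⟩ := isConj_iff.1 (Equiv.Perm.isConj_iff_cycleType_eq.2
    ((cycleType_adj_mul_adj hn).trans hαm.symm))
  obtain ⟨u, rfl⟩ := surjective_of_map_t hπt γ
  set x := u * (t n ⟨0, by omega⟩ * t n ⟨1, by omega⟩) * u⁻¹ with hx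
  have hπx : π x = α ^ m := by rw [hx, map_mul, map_mul, map_mul, map_inv, hπt, hπt, hγ]
  have hx3 : ρ x ^ 3 = -1 := by
    rw [← map_pow, hx, conj_pow, t_mul_t_pow_three rfl, map_mul, map_mul, hspin, mul_neg_one,
      neg_mul, map_mul_map_inv]
  have hx2 : ρ x ^ 2 = ρ x - 1 := by
    have h1 : ρ (t n ⟨0, by omega⟩ * t n ⟨1, by omega⟩) = spinGen ρ 0 * spinGen ρ 1 := by
      rw [map_mul, ← spinGen_eq, ← spinGen_eq]
    have hrel := spinRel_spinGen hspin
    have h2 : (spinGen ρ 0 * spinGen ρ 1) ^ 2 = spinGen ρ 0 * spinGen ρ 1 - 1 := by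
      calc (spinGen ρ 0 * spinGen ρ 1) ^ 2
          = spinGen ρ 0 * (spinGen ρ 1 * spinGen ρ 0) * spinGen ρ 1 := by noncomm_ring
        _ = spinGen ρ 0 * spinGen ρ 1 -
            spinGen ρ 0 * spinGen ρ 0 * (spinGen ρ 1 * spinGen ρ 1) := by
          rw [eq_sub_of_add_eq' hb]; noncomm_ring
        _ = _ := by rw [hrel.sq 0 (by omega), hrel.sq 1 (by omega)]; noncomm_ring
    rw [← map_pow, hx, conj_pow, map_mul, map_mul, map_pow, h1, h2, mul_sub, mul_one, sub_mul,
      map_mul_map_inv, ← h1, ← map_mul, ← map_mul]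
  have hy : IsLift (cliff (spinGen ρ) n) 1 (ρ (g ^ m * x⁻¹)) := by
    have := hl (g ^ m * x⁻¹)
    rwa [map_mul, map_inv, hpow, hπx, mul_inv_cancel] at this
  obtain ⟨c, -, hc⟩ := hy.exists_smul_one h
  have hgm : ρ g ^ m = c • ρ x := by
    rw [← map_pow, ← one_mul (ρ x), ← smul_mul_assoc, ← hc, ← map_mul, inv_mul_cancel_right]
  have hc3 : c ^ 3 = -ε := by
    rw [map_pow, pow_mul', hgm, _root_.smul_pow, hx3, smul_neg, ← neg_smul] at hg
    have := smul_left_injective ℂ (one_ne_zero : (1 : End ℂ V) ≠ 0) hg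
    rw [← this, neg_neg]
  have hc2 : c ^ 2 ^ ((n - 1) / 2 + 2) = 1 := by
    have h1 := det_map_pow_four ρ (g ^ m * x⁻¹)
    rw [hc, LinearMap.det_smul, map_one, mul_one, hdim, ← pow_mul] at h1
    rw [pow_add]
    exact h1
  refine minpoly_mul_eq hm0 hε ?_ hli
  rw [mul_comm 2 m, pow_mul, hgm, eq_neg_of_pow_three_eq_neg hε hc3 hc2, _root_.smul_pow, hx2, neg_sq, hε,
    smul_smul, mul_neg, ← pow_two, hε]
  module

end Minpoly

open Schur Polynomial in
/-- Theorem: for `n > 8`, `(ρ, V)` a basic spin representation of `S̃_n` (an irreducible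
spin representation of dimension `2^⌊(n−1)/2⌋`) and `g ∈ S̃_n` such that 3 is a solitary
part but 5 is not a solitary part of the cycle type of `π(g)`, one has `3 ∣ k` and the
minimal polynomial of `ρ(g)` is `(X^k − ε_g)/(X^{k/3} − ε_g)`, where `k` is the order of
`π(g)`. -/
theorem schur_basic_spin_minpoly_solitary_three (n : ℕ) (hn : 8 < n)
    (π : Cover n →* Equiv.Perm (Fin n))
    (hπt : ∀ i : Fin (n - 1), π (t n i) = adj n i)
    (hπz : π (z n) = 1)
    (g : Cover n) (k : ℕ) (hk : k = orderOf (π g))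
    (h3 : SolitaryPart 3 (π g)) (h5 : ¬ SolitaryPart 5 (π g))
    (V : Type) [AddCommGroup V] [Module ℂ V] [FiniteDimensional ℂ V] [Nontrivial V]
    (ρ : Cover n →* Module.End ℂ V)
    (hirr : ∀ U : Submodule ℂ V, (∀ h : Cover n, U.map (ρ h) ≤ U) → U = ⊥ ∨ U = ⊤)
    (hspin : ρ (z n) = -1)
    (hdim : Module.finrank ℂ V = 2 ^ ((n - 1) / 2))
    (ε : ℂ) (hε : (g ^ k = 1 ∧ ε = 1) ∨ (g ^ k = z n ∧ ε = -1)) :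
    3 ∣ k ∧ minpoly ℂ (ρ g) * (X ^ (k / 3) - C ε) = X ^ k - C ε := by
  subst hk
  have hrel := spinRel_spinGen hspin
  obtain ⟨c, hc⟩ := hrel.exists_core
  let _ : NormedAddCommGroup V := c.toNormedAddCommGroup
  let _ : InnerProductSpace ℂ V := InnerProductSpace.ofCore c.toCore
  have hskew : ∀ i, i + 1 < n → IsSkew (spinGen ρ i) := hc
  have hb : spinGen ρ 0 * spinGen ρ 1 + spinGen ρ 1 * spinGen ρ 0 = 1 := by
    by_contra hne
    have := (spinBound n V (spinGen ρ) hrel hskew).2 (by omega) hne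
    omega
  refine minpoly_map_of_frame hn hπt hπz h3 h5 hspin hdim hb
    (hrel.spinFrame hskew (fun i hi => hrel.basic_all hb hi)
      fun X hX => exists_eq_smul_one_of_commute hirr hspin hX) ?_ ?_
  · rcases hε with ⟨-, rfl⟩ | ⟨-, rfl⟩ <;> norm_num
  · rcases hε with ⟨h1, rfl⟩ | ⟨h1, rfl⟩
    · rw [h1, map_one, one_smul]
    · rw [h1, hspin, neg_one_smul]
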